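/- arXiv:1403.3945 — 10 statements merged into one kernel-verified Lean document; each statement's English description precedes it below -/
import Mathlib

section
/- Let (Ω, ω) be a σ-finite measure space and let K : Ω × Ω → (0, ∞] be a symmetric measurable kernel. Define the integral operator Tf(x) = ∫_Ω K(x,y) f(y) dω(y), the iterated kernels K₁ = K and K_j(x,y) = ∫_Ω K_{j-1}(x,z) K(z,y) dω(z) for j ≥ 2, and H(x,y) = Σ_{j=1}^∞ K_j(x,y). If the operator norm of T on L²(ω) satisfies ‖T‖ > 1, then H(x,y) = +∞ for every x, y ∈ Ω. -/
open MeasureTheory ENNReal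
open scoped NNReal

/-- The iterated kernels: `Kiter ω K (j-1)` is the kernel `K_j` of the paper,
i.e. `Kiter ω K 0 = K₁ = K` and
`Kiter ω K j x y = ∫ Kiter ω K (j-1) x z * K z y dω(z)`. -/
noncomputable def Kiter {Ω : Type*} [MeasurableSpace Ω] (ω : Measure Ω)
    (K : Ω → Ω → ℝ≥0∞) : ℕ → Ω → Ω → ℝ≥0∞
  | 0 => K
  | j + 1 => fun x y => ∫⁻ z, Kiter ω K j x z * K z y ∂ω

/-- The norm of the integral operator `Tf(x) = ∫ K(x,y) f(y) dω(y)` as an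
operator on `L²(ω)`.  Since the kernel is positive, the operator norm is the
supremum of `‖Tf‖₂` over nonnegative `f` with `‖f‖₂ ≤ 1`. -/
noncomputable def opNorm {Ω : Type*} [MeasurableSpace Ω] (ω : Measure Ω)
    (K : Ω → Ω → ℝ≥0∞) : ℝ≥0∞ :=
  ⨆ (f : Ω → ℝ≥0∞) (_ : Measurable f) (_ : ∫⁻ y, (f y) ^ 2 ∂ω ≤ 1),
    (∫⁻ x, (∫⁻ y, K x y * f y ∂ω) ^ 2 ∂ω) ^ (1 / 2 : ℝ)

/-- The action on nonnegative functions of the integral operator with kernel `K`. -/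
noncomputable def kernelOp {Ω : Type*} [MeasurableSpace Ω] (ω : Measure Ω)
    (K : Ω → Ω → ℝ≥0∞) (f : Ω → ℝ≥0∞) : Ω → ℝ≥0∞ :=
  fun x => ∫⁻ y, K x y * f y ∂ω

section kernelOp

variable {Ω : Type*} [MeasurableSpace Ω] {ω : Measure Ω} {K : Ω → Ω → ℝ≥0∞}

lemma kernelOp_mono {f g : Ω → ℝ≥0∞} (h : f ≤ g) : kernelOp ω K f ≤ kernelOp ω K g :=
  fun _ => lintegral_mono fun y => mul_le_mul_right (h y) _

lemma measurable_kernelOp [SigmaFinite ω] (hmeas : Measurable fun p : Ω × Ω => K p.1 p.2)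
    {f : Ω → ℝ≥0∞} (hf : Measurable f) : Measurable (kernelOp ω K f) :=
  Measurable.lintegral_prod_right' (f := fun p : Ω × Ω => K p.1 p.2 * f p.2)
    (hmeas.mul (hf.comp measurable_snd))

lemma measurable_kernelOp_iterate [SigmaFinite ω]
    (hmeas : Measurable fun p : Ω × Ω => K p.1 p.2) {f : Ω → ℝ≥0∞} (hf : Measurable f) (n : ℕ) :
    Measurable ((kernelOp ω K)^[n] f) := by
  induction n with
  | zero => exact hf
  | succ n ih =>
    rw [Function.iterate_succ_apply']
    exact measurable_kernelOp hmeas ih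

lemma lintegral_kernelOp_mul [SigmaFinite ω] (hmeas : Measurable fun p : Ω × Ω => K p.1 p.2)
    (hsymm : ∀ x y, K x y = K y x) {f g : Ω → ℝ≥0∞} (hf : Measurable f) (hg : Measurable g) :
    ∫⁻ x, kernelOp ω K f x * g x ∂ω = ∫⁻ x, f x * kernelOp ω K g x ∂ω := by
  have hK (x : Ω) : Measurable (K x) := hmeas.comp measurable_prodMk_left
  calc ∫⁻ x, kernelOp ω K f x * g x ∂ω
      = ∫⁻ x, ∫⁻ y, K x y * f y * g x ∂ω ∂ω := by
        refine lintegral_congr fun x => ?_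
        rw [kernelOp, lintegral_mul_const _ ((hK x).fun_mul hf)]
    _ = ∫⁻ y, ∫⁻ x, K x y * f y * g x ∂ω ∂ω :=
        lintegral_lintegral_swap ((hmeas.mul (hf.comp measurable_snd)).mul
          (hg.comp measurable_fst)).aemeasurable
    _ = ∫⁻ y, f y * kernelOp ω K g y ∂ω := by
        refine lintegral_congr fun y => ?_
        rw [kernelOp, ← lintegral_const_mul _ ((hK y).fun_mul hg)]
        refine lintegral_congr fun x => ?_
        rw [hsymm x y]
        ring

lemma lintegral_kernelOp_iterate_mul [SigmaFinite ω]
    (hmeas : Measurable fun p : Ω × Ω => K p.1 p.2) (hsymm : ∀ x y, K x y = K y x)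
    {f g : Ω → ℝ≥0∞} (hf : Measurable f) (hg : Measurable g) (m n : ℕ) :
    ∫⁻ x, (kernelOp ω K)^[m + n] f x * g x ∂ω =
      ∫⁻ x, (kernelOp ω K)^[m] f x * (kernelOp ω K)^[n] g x ∂ω := by
  induction n generalizing g with
  | zero => rfl
  | succ n ih =>
    rw [← add_assoc, Function.iterate_succ_apply',
      lintegral_kernelOp_mul hmeas hsymm (measurable_kernelOp_iterate hmeas hf _) hg,
      ih (measurable_kernelOp hmeas hg), Function.iterate_succ_apply]

lemma kernelOp_const_mul {c : ℝ≥0∞} (hc : c ≠ ∞) (f : Ω → ℝ≥0∞) :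
    kernelOp ω K (fun y => c * f y) = fun x => c * kernelOp ω K f x := by
  funext x
  simp only [kernelOp]
  rw [← lintegral_const_mul' _ _ hc]
  exact lintegral_congr fun y => mul_left_comm _ _ _

lemma kernelOp_iterate_le_const_mul {c : ℝ≥0∞} (hc : c ≠ ∞) {f g : Ω → ℝ≥0∞}
    (h : ∀ x, f x ≤ c * g x) (n : ℕ) (x : Ω) :
    (kernelOp ω K)^[n] f x ≤ c * (kernelOp ω K)^[n] g x := by
  induction n generalizing x with
  | zero => exact h x
  | succ n ih =>
    simp only [Function.iterate_succ_apply']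
    exact (kernelOp_mono ih x).trans_eq (congrFun (kernelOp_const_mul hc _) x)

lemma Kiter_eq_kernelOp_iterate (hsymm : ∀ x y, K x y = K y x) (j : ℕ) (x : Ω) :
    Kiter ω K j x = (kernelOp ω K)^[j] (K x) := by
  induction j with
  | zero => rfl
  | succ j ih =>
    rw [Function.iterate_succ_apply', ← ih]
    funext y
    refine lintegral_congr fun z => ?_
    rw [hsymm z y, mul_comm]

lemma lintegral_kernelOp_iterate_mul_le_Kiter (hsymm : ∀ x y, K x y = K y x)
    {c : ℝ≥0∞} (hc : c ≠ ∞) {f : Ω → ℝ≥0∞} {x y : Ω}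
    (hx : ∀ z, f z ≤ c * K x z) (hy : ∀ z, f z ≤ c * K z y) (j : ℕ) :
    ∫⁻ z, (kernelOp ω K)^[j] f z * f z ∂ω ≤ c * c * Kiter ω K (j + 1) x y := by
  rw [Kiter, ← lintegral_const_mul' _ _ (mul_ne_top hc hc)]
  refine lintegral_mono fun z => ?_
  rw [Kiter_eq_kernelOp_iterate hsymm, mul_mul_mul_comm]
  exact mul_le_mul' (kernelOp_iterate_le_const_mul hc hx j z) (hy z)

end kernelOp

lemma sq_lintegral_mul_le {Ω : Type*} [MeasurableSpace Ω] {ω : Measure Ω} {f g : Ω → ℝ≥0∞}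
    (hf : Measurable f) (hg : Measurable g) :
    (∫⁻ x, f x * g x ∂ω) ^ 2 ≤ (∫⁻ x, f x ^ 2 ∂ω) * ∫⁻ x, g x ^ 2 ∂ω := by
  have h := ENNReal.lintegral_mul_le_Lp_mul_Lq ω Real.HolderConjugate.two_two
    hf.aemeasurable hg.aemeasurable
  simp only [Pi.mul_apply, rpow_two] at h
  refine (pow_le_pow_left' h 2).trans_eq ?_
  rw [mul_pow, ← rpow_two, ← rpow_two, ← rpow_mul, ← rpow_mul]
  norm_num

lemma monotone_of_sq_le_mul {b : ℕ → ℝ≥0∞} (htop : ∀ k, b k ≠ ∞) (h₀ : b 0 ≤ b 1)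
    (hb : ∀ k, b (k + 1) ^ 2 ≤ b k * b (k + 2)) : Monotone b := by
  refine monotone_nat_of_le_succ fun k => ?_
  induction k with
  | zero => exact h₀
  | succ k ih =>
    rcases eq_or_ne (b (k + 1)) 0 with h | h
    · simp [h]
    · refine (ENNReal.mul_le_mul_iff_right h (htop _)).1 ?_
      rw [← sq]
      exact (hb k).trans (mul_le_mul_left ih _)

lemma iSup_min_natCast_mul (a : ℝ≥0∞) {u : ℝ≥0∞} (hu : u ≠ 0) :
    ⨆ n : ℕ, min a (n * u) = a := by
  have h : ⨆ n : ℕ, (n : ℝ≥0∞) * u = ∞ := by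
    rw [← ENNReal.iSup_mul, ENNReal.iSup_natCast, top_mul hu]
  rw [← inf_iSup_eq, h, inf_top_eq]

/-- A function of norm at most one on which the operator is expanding can be replaced by one that
is moreover dominated by a multiple of a given positive function. -/
lemma exists_le_const_mul_of_one_lt_opNorm {Ω : Type*} [MeasurableSpace Ω] {ω : Measure Ω}
    [SigmaFinite ω] {K : Ω → Ω → ℝ≥0∞} (hmeas : Measurable fun p : Ω × Ω => K p.1 p.2)
    (hnorm : 1 < opNorm ω K) {u : Ω → ℝ≥0∞} (hu : Measurable u) (hu₀ : ∀ z, u z ≠ 0) :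
    ∃ (n : ℕ) (f : Ω → ℝ≥0∞), Measurable f ∧ (∀ z, f z ≤ n * u z) ∧
      ∫⁻ z, f z ^ 2 ∂ω ≤ 1 ∧ 1 < ∫⁻ z, kernelOp ω K f z ^ 2 ∂ω := by
  obtain ⟨f, hf, hf₁, hlt⟩ : ∃ f, Measurable f ∧ ∫⁻ y, f y ^ 2 ∂ω ≤ 1 ∧
      1 < ∫⁻ x, kernelOp ω K f x ^ 2 ∂ω := by
    simp only [opNorm, lt_iSup_iff] at hnorm
    obtain ⟨f, hf, hf₁, h⟩ := hnorm
    refine ⟨f, hf, hf₁, ?_⟩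
    by_contra! hle
    exact h.not_ge (rpow_le_one hle (by norm_num))
  let F : ℕ → Ω → ℝ≥0∞ := fun n z => min (f z) (n * u z)
  have hF (n : ℕ) : Measurable (F n) := hf.min (hu.const_mul _)
  have hFmono : Monotone F := fun m n hmn z =>
    min_le_min_left _ (mul_le_mul_left (Nat.cast_le.2 hmn) _)
  have hK (x : Ω) : Measurable (K x) := hmeas.comp measurable_prodMk_left
  have hsup (x : Ω) : kernelOp ω K f x = ⨆ n, kernelOp ω K (F n) x := by
    simp only [kernelOp]
    rw [← lintegral_iSup (fun n => (hK x).fun_mul (hF n))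
      fun m n hmn z => mul_le_mul_right (hFmono hmn z) _]
    refine lintegral_congr fun z => ?_
    rw [← ENNReal.mul_iSup, iSup_min_natCast_mul _ (hu₀ z)]
  have hsq (x : Ω) : kernelOp ω K f x ^ 2 = ⨆ n, kernelOp ω K (F n) x ^ 2 := by
    rw [hsup, ENNReal.iSup_pow]
  simp only [hsq] at hlt
  rw [lintegral_iSup (fun n => (measurable_kernelOp hmeas (hF n)).pow_const 2)
    fun m n hmn x => pow_le_pow_left' (kernelOp_mono (hFmono hmn) x) 2, lt_iSup_iff] at hlt
  obtain ⟨n, hn⟩ := hlt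
  exact ⟨n, F n, hF n, fun z => min_le_right _ _,
    (lintegral_mono fun z => pow_le_pow_left' (min_le_left _ _) 2).trans hf₁, hn⟩

/-- if `K` is a symmetric measurable positive kernel whose
integral operator on `L²(ω)` has norm `> 1`, then the Green's function
`H(x,y) = Σ_{j=1}^∞ K_j(x,y)` is identically `+∞`. -/
theorem green_function_eq_top_of_one_lt_opNorm {Ω : Type*} [MeasurableSpace Ω]
    (ω : Measure Ω) [SigmaFinite ω] (K : Ω → Ω → ℝ≥0∞)
    (hmeas : Measurable fun p : Ω × Ω => K p.1 p.2)
    (hpos : ∀ x y, K x y ≠ 0)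
    (hsymm : ∀ x y, K x y = K y x)
    (hnorm : 1 < opNorm ω K) :
    ∀ x y, ∑' j : ℕ, Kiter ω K j x y = ∞ := by
  intro x y
  have hK (x : Ω) : Measurable (K x) := hmeas.comp measurable_prodMk_left
  obtain ⟨n, f, hf, hfle, hf₁, hlt⟩ := exists_le_const_mul_of_one_lt_opNorm hmeas hnorm
    (u := fun z => min (K x z) (K y z)) ((hK x).min (hK y))
    fun z => (lt_min (hpos x z).bot_lt (hpos y z).bot_lt).ne'
  have hx (z : Ω) : f z ≤ n * K x z := (hfle z).trans (mul_le_mul_right (min_le_left _ _) _)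
  have hy (z : Ω) : f z ≤ n * K z y := by
    rw [hsymm z y]
    exact (hfle z).trans (mul_le_mul_right (min_le_right _ _) _)
  by_contra hH
  let c : ℕ → ℝ≥0∞ := fun j => ∫⁻ z, (kernelOp ω K)^[j] f z * f z ∂ω
  have hn : (n : ℝ≥0∞) ≠ ∞ := natCast_ne_top n
  have hc : ∑' j, c j ≠ ∞ := by
    refine ne_top_of_le_ne_top (mul_ne_top (mul_ne_top hn hn) hH) ?_
    calc ∑' j, c j ≤ ∑' j, n * n * Kiter ω K (j + 1) x y :=
          ENNReal.tsum_le_tsum (lintegral_kernelOp_iterate_mul_le_Kiter hsymm hn hx hy)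
      _ = n * n * ∑' j, Kiter ω K (j + 1) x y := ENNReal.tsum_mul_left
      _ ≤ n * n * ∑' j, Kiter ω K j x y :=
          mul_le_mul_right (ENNReal.tsum_comp_le_tsum_of_injective
            (add_left_injective 1) fun j => Kiter ω K j x y) _
  let b : ℕ → ℝ≥0∞ := fun k => ∫⁻ z, (kernelOp ω K)^[k] f z ^ 2 ∂ω
  have hbc (k : ℕ) : b k = c (k + k) := by
    simp only [b, c, sq, lintegral_kernelOp_iterate_mul hmeas hsymm hf hf]
  have hlog (k : ℕ) : b (k + 1) ^ 2 ≤ b k * b (k + 2) := by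
    have h : b (k + 1) = ∫⁻ z, (kernelOp ω K)^[k] f z * (kernelOp ω K)^[k + 2] f z ∂ω := by
      rw [hbc, ← lintegral_kernelOp_iterate_mul hmeas hsymm hf hf]
      simp only [c]
      congr! 4
      ring
    rw [h]
    exact sq_lintegral_mul_le (measurable_kernelOp_iterate hmeas hf _)
      (measurable_kernelOp_iterate hmeas hf _)
  have hmono : Monotone b := monotone_of_sq_le_mul
    (fun k => hbc k ▸ ENNReal.ne_top_of_tsum_ne_top hc _) (hf₁.trans hlt.le) hlog
  have hlim := ENNReal.tendsto_atTop_zero_of_tsum_ne_top hc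
  obtain ⟨N, hN⟩ := Filter.eventually_atTop.1 (hlim.eventually_lt_const zero_lt_one)
  have h₁ : c (N + 1 + (N + 1)) < 1 := hN _ (by omega)
  have h₂ : b 1 ≤ b (N + 1) := hmono (by omega)
  rw [← hbc] at h₁
  exact (hlt.trans_le h₂).not_gt h₁
end

section
/- (Ptolemy) Let d be a quasi-metric with constant κ on a set Ω. Suppose y₁, y₂, y₃, y₄ ∈ Ω, and set a = d(y₁,y₂), b = d(y₂,y₃), c = d(y₃,y₄), e = d(y₄,y₁), s = d(y₂,y₄), t = d(y₁,y₃). Then s·t ≤ 4κ² · max(a·c, b·e). -/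
/-- A quasi-metric with constant `κ` on a set `Ω`. -/
structure IsQuasiMetric {Ω : Type*} (d : Ω → Ω → ℝ) (κ : ℝ) : Prop where
  nonneg : ∀ x y, 0 ≤ d x y
  nontrivial : ∃ x y, d x y ≠ 0
  symm : ∀ x y, d x y = d y x
  tri : ∀ x y z, d x y ≤ κ * (d x z + d z y)

/-- `d x y` is at most `2 * κ` times the longer of the two sides through any third point. -/
theorem IsQuasiMetric.le_two_mul {Ω : Type*} {d : Ω → Ω → ℝ} {κ : ℝ} (hd : IsQuasiMetric d κ)
    (hκ : 0 ≤ κ) {x y z : Ω} {r : ℝ} (hx : d x z ≤ r) (hy : d z y ≤ r) :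
    d x y ≤ 2 * κ * r :=
  calc d x y ≤ κ * (d x z + d z y) := hd.tri x y z
    _ ≤ κ * (r + r) := by gcongr
    _ = 2 * κ * r := by ring

/-- Ptolemy: with `a = d(y₁,y₂)`, `b = d(y₂,y₃)`, `c = d(y₃,y₄)`,
`e = d(y₄,y₁)`, `s = d(y₂,y₄)`, `t = d(y₁,y₃)`, we have
`s·t ≤ 4κ² · max (a·c) (b·e)`. -/
theorem ptolemy {Ω : Type*} (d : Ω → Ω → ℝ) (κ : ℝ) (hκ : 0 < κ)
    (hd : IsQuasiMetric d κ) (y₁ y₂ y₃ y₄ : Ω) :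
    d y₂ y₄ * d y₁ y₃ ≤
      4 * κ ^ 2 * max (d y₁ y₂ * d y₃ y₄) (d y₂ y₃ * d y₄ y₁) := by
  have key {p q : ℝ} (hs : d y₂ y₄ ≤ 2 * κ * p) (ht : d y₁ y₃ ≤ 2 * κ * q)
      (hpq : p * q ≤ max (d y₁ y₂ * d y₃ y₄) (d y₂ y₃ * d y₄ y₁)) :
      d y₂ y₄ * d y₁ y₃ ≤ 4 * κ ^ 2 * max (d y₁ y₂ * d y₃ y₄) (d y₂ y₃ * d y₄ y₁) :=
    calc d y₂ y₄ * d y₁ y₃ ≤ (2 * κ * p) * (2 * κ * q) :=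
          mul_le_mul hs ht (hd.nonneg _ _) ((hd.nonneg _ _).trans hs)
      _ = 4 * κ ^ 2 * (p * q) := by ring
      _ ≤ _ := by gcongr
  have h₂₁ := hd.symm y₂ y₁
  have h₁₄ := hd.symm y₁ y₄
  have h₄₃ := hd.symm y₄ y₃
  -- Bound both diagonals through the endpoints of the shortest side.
  have hmin : (d y₁ y₂ ≤ d y₂ y₃ ∧ d y₁ y₂ ≤ d y₄ y₁) ∨ (d y₃ y₄ ≤ d y₂ y₃ ∧ d y₃ y₄ ≤ d y₄ y₁) ∨
      (d y₂ y₃ ≤ d y₁ y₂ ∧ d y₂ y₃ ≤ d y₃ y₄) ∨ (d y₄ y₁ ≤ d y₁ y₂ ∧ d y₄ y₁ ≤ d y₃ y₄) := by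
    grind
  rcases hmin with ⟨h, h'⟩ | ⟨h, h'⟩ | ⟨h, h'⟩ | ⟨h, h'⟩
  · exact key (hd.le_two_mul hκ.le (z := y₁) (h₂₁.trans_le h') h₁₄.le)
      (hd.le_two_mul hκ.le (z := y₂) h le_rfl) (by rw [mul_comm]; exact le_max_right _ _)
  · exact key (hd.le_two_mul hκ.le (z := y₃) le_rfl h)
      (hd.le_two_mul hκ.le (z := y₄) h₁₄.le (h₄₃.trans_le h')) (le_max_right _ _)
  · exact key (hd.le_two_mul hκ.le (z := y₃) h' le_rfl)
      (hd.le_two_mul hκ.le (z := y₂) le_rfl h) (by rw [mul_comm]; exact le_max_left _ _)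
  · exact key (hd.le_two_mul hκ.le (z := y₁) h₂₁.le (h₁₄.trans_le h))
      (hd.le_two_mul hκ.le (z := y₄) (h₁₄.trans_le h') h₄₃.le) (le_max_left _ _)
end

section
/- (Ptolemy inequality for quasi-metrics) Let d be a quasi-metric with constant κ on a set Ω. Then for all y₁, y₂, y₃, y₄ ∈ Ω, d(y₁,y₃)·d(y₂,y₄) ≤ 4κ²·( d(y₁,y₂)·d(y₃,y₄) + d(y₁,y₄)·d(y₂,y₃) ). -/
/-- Ptolemy inequality for quasi-metrics:
`d(y₁,y₃)·d(y₂,y₄) ≤ 4κ²·( d(y₁,y₂)·d(y₃,y₄) + d(y₁,y₄)·d(y₂,y₃) )`. -/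
theorem ptolemy_inequality {Ω : Type*} (d : Ω → Ω → ℝ) (κ : ℝ) (hκ : 0 < κ)
    (hd : IsQuasiMetric d κ) (y₁ y₂ y₃ y₄ : Ω) :
    d y₁ y₃ * d y₂ y₄ ≤
      4 * κ ^ 2 * (d y₁ y₂ * d y₃ y₄ + d y₁ y₄ * d y₂ y₃) := by
  have bound_of_le {u v w : Ω} {t : ℝ} (hu : d u w ≤ t) (hv : d w v ≤ t) :
      d u v ≤ 2 * κ * t := by
    nlinarith [hd.tri u v w]
  have mul_bound {p q s t r : ℝ} (hq0 : 0 ≤ q) (hs : 0 ≤ s) (hr : 0 ≤ r)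
      (hp : p ≤ 2 * κ * s) (hq : q ≤ 2 * κ * t) : p * q ≤ 4 * κ ^ 2 * (s * t + r) := by
    calc p * q ≤ (2 * κ * s) * (2 * κ * t) := mul_le_mul hp hq hq0 (by positivity)
      _ = 4 * κ ^ 2 * (s * t) := by ring
      _ ≤ 4 * κ ^ 2 * (s * t + r) := by gcongr; linarith
  have h12 := hd.nonneg y₁ y₂
  have h23 := hd.nonneg y₂ y₃
  have h34 := hd.nonneg y₃ y₄
  have h14 := hd.nonneg y₁ y₄
  have h24 := hd.nonneg y₂ y₄
  have s12 := hd.symm y₂ y₁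
  have s23 := hd.symm y₃ y₂
  have s34 := hd.symm y₄ y₃
  -- Pass through the shortest side of the quadrilateral; it is at most its two neighbours.
  have hmin : (d y₁ y₂ ≤ d y₂ y₃ ∧ d y₁ y₂ ≤ d y₁ y₄) ∨ (d y₃ y₄ ≤ d y₂ y₃ ∧ d y₃ y₄ ≤ d y₁ y₄) ∨
      (d y₂ y₃ ≤ d y₁ y₂ ∧ d y₂ y₃ ≤ d y₃ y₄) ∨ (d y₁ y₄ ≤ d y₁ y₂ ∧ d y₁ y₄ ≤ d y₃ y₄) := by
    grind
  rcases hmin with ⟨h, h'⟩ | ⟨h, h'⟩ | ⟨h, h'⟩ | ⟨h, h'⟩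
  · have := mul_bound h24 h23 (mul_nonneg h12 h34)
      (bound_of_le h le_rfl) (bound_of_le (s12.trans_le h') le_rfl)
    linarith
  · have := mul_bound h24 h14 (mul_nonneg h12 h34)
      (bound_of_le le_rfl (s34.trans_le h')) (bound_of_le le_rfl h)
    linarith
  · exact mul_bound h24 h12 (mul_nonneg h14 h23)
      (bound_of_le le_rfl h) (bound_of_le h' le_rfl)
  · have := mul_bound h24 h34 (mul_nonneg h14 h23)
      (bound_of_le h' s34.le) (bound_of_le s12.le h)
    linarith
end

section
/- (Inverse Ptolemy) Let D be a quasi-metric with constant 1 on a set Ω. Let y₁, y₂, y₃, y₄ ∈ Ω and set a = D(y₁,y₂), b = D(y₂,y₃), c = D(y₃,y₄), e = D(y₄,y₁), s = D(y₂,y₄), t = D(y₁,y₃). If a·c ≥ τ²·b·e for some τ > 1, then s·t ≥ (1 − τ⁻¹)² · a·c. -/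
/-- The inequality behind the inverse Ptolemy theorem, for six real numbers with `c ≤ a`. -/
theorem sq_one_sub_mul_le_of_triangle {a b c e s t q : ℝ} (hc : 0 ≤ c)
    (hq : 0 < q) (hq1 : q < 1) (hca : c ≤ a)
    (h : b * e ≤ (q * a) * (q * c))
    (hsa : a ≤ s + e) (hsc : c ≤ s + b) (hta : a ≤ t + b) (htc : c ≤ t + e) :
    (1 - q) ^ 2 * (a * c) ≤ s * t := by
  have ha : 0 ≤ a := hc.trans hca
  have hqa : 0 ≤ q * a := mul_nonneg hq.le ha
  have hqca : q * c ≤ q * a := mul_le_mul_of_nonneg_left hca hq.le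
  have h1q : 0 ≤ 1 - q := by linarith
  have hA : 0 ≤ (1 - q) * a := mul_nonneg h1q ha
  have hC : 0 ≤ (1 - q) * c := mul_nonneg h1q hc
  have hCA : (1 - q) * c ≤ (1 - q) * a := mul_le_mul_of_nonneg_left hca h1q
  rcases lt_or_ge (q * a) e with he' | he'
  · have hbc : b ≤ q * c := by
      by_contra! hlt
      nlinarith [mul_nonneg hq.le hc]
    have hs : (1 - q) * c ≤ s := by linarith
    have ht : (1 - q) * a ≤ t := by linarith
    linarith [mul_le_mul hs ht hA (hC.trans hs)]
  · rcases lt_or_ge (q * a) b with hb' | hb'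
    · have hec : e ≤ q * c := by
        by_contra! hlt
        nlinarith [mul_nonneg hq.le hc]
      have hs : (1 - q) * a ≤ s := by linarith
      have ht : (1 - q) * c ≤ t := by linarith
      linarith [mul_le_mul hs ht hC (hA.trans hs)]
    · have hs : (1 - q) * a ≤ s := by linarith
      have ht : (1 - q) * c ≤ t := by linarith
      linarith [mul_le_mul hs ht hC (hA.trans hs)]

/-- Inverse Ptolemy: for a quasi-metric `D` with constant 1,
with `a = D(y₁,y₂)`, `b = D(y₂,y₃)`, `c = D(y₃,y₄)`, `e = D(y₄,y₁)`,
`s = D(y₂,y₄)`, `t = D(y₁,y₃)`: if `a·c ≥ τ²·b·e` with `τ > 1`, then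
`s·t ≥ (1 − τ⁻¹)² · a·c`. -/
theorem inverse_ptolemy {Ω : Type*} (D : Ω → Ω → ℝ)
    (hD : IsQuasiMetric D 1) (y₁ y₂ y₃ y₄ : Ω) (τ : ℝ) (hτ : 1 < τ)
    (h : τ ^ 2 * (D y₂ y₃ * D y₄ y₁) ≤ D y₁ y₂ * D y₃ y₄) :
    (1 - τ⁻¹) ^ 2 * (D y₁ y₂ * D y₃ y₄) ≤ D y₂ y₄ * D y₁ y₃ := by
  have hτ0 : 0 < τ := one_pos.trans hτ
  have hq : 0 < τ⁻¹ := inv_pos.mpr hτ0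
  have hq1 : τ⁻¹ < 1 := inv_lt_one_of_one_lt₀ hτ
  have hbe : D y₂ y₃ * D y₄ y₁ ≤ (τ⁻¹ * D y₁ y₂) * (τ⁻¹ * D y₃ y₄) := by
    calc D y₂ y₃ * D y₄ y₁ = τ⁻¹ ^ 2 * (τ ^ 2 * (D y₂ y₃ * D y₄ y₁)) := by field_simp
      _ ≤ τ⁻¹ ^ 2 * (D y₁ y₂ * D y₃ y₄) := mul_le_mul_of_nonneg_left h (by positivity)
      _ = _ := by ring
  have hsa := hD.tri y₁ y₂ y₄
  have hsc := hD.tri y₃ y₄ y₂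
  have hta := hD.tri y₁ y₂ y₃
  have htc := hD.tri y₃ y₄ y₁
  rw [hD.symm y₁ y₄, hD.symm y₄ y₂] at hsa
  rw [hD.symm y₃ y₂] at hsc
  rw [hD.symm y₃ y₂] at hta
  rw [hD.symm y₃ y₁, hD.symm y₁ y₄] at htc
  rcases le_total (D y₃ y₄) (D y₁ y₂) with hca | hac
  · exact sq_one_sub_mul_le_of_triangle (hD.nonneg y₃ y₄) hq hq1 hca hbe
      (by linarith) (by linarith) (by linarith) (by linarith)
  · rw [mul_comm (D y₁ y₂)]
    exact sq_one_sub_mul_le_of_triangle (b := D y₄ y₁) (e := D y₂ y₃) (hD.nonneg y₁ y₂)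
      hq hq1 hac (by linarith)
      (by linarith) (by linarith) (by linarith) (by linarith)
end

section
/- Let d be a quasi-metric with constant κ on a set Ω, and let D be a quasi-metric with constant 1 on Ω satisfying D^β ≤ d ≤ (2κ)²·D^β with β = 2 log₂(2κ). Let x, y, u, v ∈ Ω with D positive at the relevant pairs. If for some τ > 1 one has D(x,v)/D(y,v) ≥ τ² · D(x,u)/D(y,u), then d(x,y)·d(u,v) ≥ (1 − τ⁻¹)^{2β} · (2κ)^{-4} · d(x,v)·d(y,u). -/
theorem IsQuasiMetric.one_le_two_mul {Ω : Type*} {d : Ω → Ω → ℝ} {κ : ℝ}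
    (hd : IsQuasiMetric d κ) : 1 ≤ 2 * κ := by
  obtain ⟨x, y, hxy⟩ := hd.nontrivial
  have hpos : 0 < d x y := lt_of_le_of_ne (hd.nonneg x y) hxy.symm
  rcases (hd.nonneg x x).eq_or_lt with h0 | h0
  · have := hd.tri x y x
    rw [← h0, zero_add] at this
    nlinarith
  · have := hd.tri x x x
    nlinarith

/-- If the product of one pair of opposite sides of a quadrilateral is small compared with the
product of the diagonals, then the product of the other pair is not. -/
theorem IsQuasiMetric.sq_mul_mul_le {Ω : Type*} {D : Ω → Ω → ℝ} (hD : IsQuasiMetric D 1)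
    {x y u v : Ω} {t : ℝ} (ht₀ : 0 ≤ t) (ht₁ : t ≤ 1)
    (h : D x u * D y v ≤ (t * D x v) * (t * D y u)) :
    (1 - t) ^ 2 * (D x v * D y u) ≤ D x y * D u v := by
  have h₁ := hD.tri x v y
  have h₂ := hD.tri x v u
  have h₃ := hD.tri y u x
  have h₄ := hD.tri y u v
  rw [hD.symm y x] at h₃
  rw [hD.symm v u] at h₄
  have hp := hD.nonneg x v
  have hq := hD.nonneg y u
  have hr := hD.nonneg x u
  have hs := hD.nonneg y v
  generalize D x v = p at *
  generalize D y u = q at *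
  generalize D x u = r at *
  generalize D y v = s at *
  generalize D x y = a at *
  generalize D u v = b at *
  have htp : 0 ≤ t * p := mul_nonneg ht₀ hp
  have htq : 0 ≤ t * q := mul_nonneg ht₀ hq
  have hp' : 0 ≤ (1 - t) * p := mul_nonneg (by linarith) hp
  have hq' : 0 ≤ (1 - t) * q := mul_nonneg (by linarith) hq
  have of_le : (1 - t) * p ≤ a → (1 - t) * q ≤ b → (1 - t) ^ 2 * (p * q) ≤ a * b := fun ha hb => by
    nlinarith [mul_le_mul ha hb hq' (hp'.trans ha)]
  have of_le' : (1 - t) * q ≤ a → (1 - t) * p ≤ b → (1 - t) ^ 2 * (p * q) ≤ a * b := fun ha hb => by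
    nlinarith [mul_le_mul ha hb hp' (hq'.trans ha)]
  have hrs : r ≤ t * p ∨ s ≤ t * q := by
    by_contra! hc
    nlinarith [mul_lt_mul'' hc.1 hc.2 htp htq]
  have hrs' : r ≤ t * q ∨ s ≤ t * p := by
    by_contra! hc
    nlinarith [mul_lt_mul'' hc.1 hc.2 htq htp]
  rcases le_total p q with hpq | hpq
  · have := mul_le_mul_of_nonneg_left hpq ht₀
    have := mul_le_mul_of_nonneg_left hpq (sub_nonneg.2 ht₁)
    rcases hrs with hr' | hs'
    · exact of_le' (by linarith) (by linarith)
    · rcases hrs' with _ | _ <;> exact of_le (by linarith) (by linarith)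
  · have := mul_le_mul_of_nonneg_left hpq ht₀
    have := mul_le_mul_of_nonneg_left hpq (sub_nonneg.2 ht₁)
    rcases hrs with hr' | hs'
    · rcases hrs' with _ | _ <;> exact of_le' (by linarith) (by linarith)
    · exact of_le (by linarith) (by linarith)

/-- let `d` be a quasi-metric with constant `κ` and `D` a
quasi-metric with constant 1 satisfying `D^β ≤ d ≤ (2κ)²·D^β`, with
`β = 2 log₂(2κ)`.  If `D(x,v)/D(y,v) ≥ τ² · D(x,u)/D(y,u)` for some `τ > 1`,
then `d(x,y)·d(u,v) ≥ (1 − τ⁻¹)^{2β}·(2κ)^{-4}·d(x,v)·d(y,u)`. -/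
theorem ptolemy_inverted {Ω : Type*} (d D : Ω → Ω → ℝ) (κ β : ℝ)
    (hκ : 0 < κ) (hd : IsQuasiMetric d κ) (hD : IsQuasiMetric D 1)
    (hβ : β = 2 * Real.logb 2 (2 * κ))
    (hcomp : ∀ x y, D x y ^ β ≤ d x y ∧ d x y ≤ (2 * κ) ^ 2 * D x y ^ β)
    (x y u v : Ω) (hyv : 0 < D y v) (hyu : 0 < D y u)
    (τ : ℝ) (hτ : 1 < τ)
    (h : τ ^ 2 * (D x u / D y u) ≤ D x v / D y v) :
    (1 - τ⁻¹) ^ (2 * β) * ((2 * κ) ^ 4)⁻¹ * (d x v * d y u) ≤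
      d x y * d u v := by
  have hK : 1 ≤ 2 * κ := hd.one_le_two_mul
  have hβ₀ : 0 ≤ β := by
    rw [hβ]
    exact mul_nonneg zero_le_two (Real.logb_nonneg one_lt_two hK)
  have hτ₀ : 0 < τ := zero_lt_one.trans hτ
  have ht₁ : τ⁻¹ ≤ 1 := inv_le_one_of_one_le₀ hτ.le
  have ht : 0 ≤ 1 - τ⁻¹ := sub_nonneg.2 ht₁
  have hprod : D x u * D y v ≤ (τ⁻¹ * D x v) * (τ⁻¹ * D y u) := by
    rw [← mul_div_assoc, div_le_div_iff₀ hyu hyv] at h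
    have : (τ⁻¹ * D x v) * (τ⁻¹ * D y u) = D x v * D y u / τ ^ 2 := by field_simp
    rw [this, le_div_iff₀ (by positivity)]
    linarith
  have hmain := hD.sq_mul_mul_le (inv_nonneg.2 hτ₀.le) ht₁ hprod
  have hxv := hD.nonneg x v
  have hxy := hD.nonneg x y
  have huv := hD.nonneg u v
  have hpow : (1 - τ⁻¹) ^ (2 * β) * (D x v ^ β * D y u ^ β) ≤ D x y ^ β * D u v ^ β := by
    rw [Real.rpow_mul ht, Real.rpow_two, ← Real.mul_rpow hxv hyu.le, ← Real.mul_rpow hxy huv,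
      ← Real.mul_rpow (by positivity) (by positivity)]
    exact Real.rpow_le_rpow (by positivity) hmain hβ₀
  calc (1 - τ⁻¹) ^ (2 * β) * ((2 * κ) ^ 4)⁻¹ * (d x v * d y u)
      ≤ (1 - τ⁻¹) ^ (2 * β) * ((2 * κ) ^ 4)⁻¹ *
          (((2 * κ) ^ 2 * D x v ^ β) * ((2 * κ) ^ 2 * D y u ^ β)) := by
        have := mul_le_mul (hcomp x v).2 (hcomp y u).2 (hd.nonneg y u) (by positivity)
        gcongr
    _ = (1 - τ⁻¹) ^ (2 * β) * (D x v ^ β * D y u ^ β) := by field_simp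
    _ ≤ D x y ^ β * D u v ^ β := hpow
    _ ≤ d x y * d u v :=
        mul_le_mul (hcomp x y).1 (hcomp u v).1 (by positivity) (hd.nonneg x y)
end

section
/- Let (Ω, ω) be a σ-finite measure space and let K be a quasi-metric kernel with constant κ on Ω. Define K₁ = K, K_j(x,y) = ∫_Ω K_{j-1}(x,z) K(z,y) dω(z) for j ≥ 2, and H(x,y) = Σ_{j=1}^∞ K_j(x,y). Then with c = (4κ²)^{-1}, for all x, y ∈ Ω: H(x,y) ≥ K(x,y) · exp( c · K₂(x,y)/K(x,y) ). -/
open MeasureTheory ENNReal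
open scoped NNReal

/-- A quasi-metric kernel with constant `κ`. -/
structure IsQuasiMetricKernel {Ω : Type*} [MeasurableSpace Ω]
    (K : Ω → Ω → ℝ≥0∞) (κ : ℝ≥0) : Prop where
  measurable : Measurable fun p : Ω × Ω => K p.1 p.2
  pos : ∀ x y, K x y ≠ 0
  symm : ∀ x y, K x y = K y x
  tri : ∀ x y z, (K x y)⁻¹ ≤ (κ : ℝ≥0∞) * ((K x z)⁻¹ + (K z y)⁻¹)

/-- The exponential function extended to `[0,∞]`. -/
noncomputable def eexp (x : ℝ≥0∞) : ℝ≥0∞ :=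
  if x = ∞ then ∞ else ENNReal.ofReal (Real.exp x.toReal)

theorem measure_univ_pow_le_lintegral_sublevel_pow {Ω α : Type*} [MeasurableSpace Ω]
    [LinearOrder α] [TopologicalSpace α] [OrderClosedTopology α] [SecondCountableTopology α]
    [MeasurableSpace α] [OpensMeasurableSpace α]
    (ν : Measure Ω) [SigmaFinite ν] {ρ : Ω → α} (hρ : Measurable ρ) (n : ℕ) :
    ν Set.univ ^ (n + 1) ≤ (n + 1) * ∫⁻ z, ν {w | ρ w ≤ ρ z} ^ n ∂ν := by
  let S : Fin (n + 1) → Set (Fin (n + 1) → Ω) := fun i => {f | ∀ j, ρ (f j) ≤ ρ (f i)}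
  have hcover : (Set.univ : Set (Fin (n + 1) → Ω)) ⊆ ⋃ i, S i := by
    intro f _
    obtain ⟨i, hi⟩ := Finite.exists_max fun i => ρ (f i)
    exact Set.mem_iUnion.2 ⟨i, hi⟩
  have hS (i : Fin (n + 1)) :
      Measure.pi (fun _ => ν) (S i) = ∫⁻ z, ν {w | ρ w ≤ ρ z} ^ n ∂ν := by
    let T : Set (Ω × (Fin n → Ω)) := {p | ∀ j, ρ (p.2 j) ≤ ρ p.1}
    have hT : MeasurableSet T := by
      have hT' : T = ⋂ j, {p : Ω × (Fin n → Ω) | ρ (p.2 j) ≤ ρ p.1} := by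
        ext p
        simp [T]
      rw [hT']
      refine MeasurableSet.iInter fun j => measurableSet_le ?_ ?_
      · exact hρ.comp ((measurable_pi_apply j).comp measurable_snd)
      · exact hρ.comp measurable_fst
    have hmp := measurePreserving_piFinSuccAbove (fun _ : Fin (n + 1) => ν) i
    have hpre : S i = MeasurableEquiv.piFinSuccAbove (fun _ => Ω) i ⁻¹' T := by
      ext f
      simp only [S, T, Fin.forall_iff_succAbove i, Set.mem_ofPred_eq, le_refl, true_and,
        Set.mem_preimage]
      rfl
    rw [hpre, hmp.measure_preimage hT.nullMeasurableSet, Measure.prod_apply hT]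
    refine lintegral_congr fun z => ?_
    have hfib : Prod.mk z ⁻¹' T = Set.univ.pi fun _ : Fin n => {w | ρ w ≤ ρ z} := by
      ext f
      simp [T]
    rw [hfib, Measure.pi_pi]
    simp
  calc ν Set.univ ^ (n + 1)
      = Measure.pi (fun _ : Fin (n + 1) => ν) Set.univ := by simp [Measure.pi_univ]
    _ ≤ Measure.pi (fun _ : Fin (n + 1) => ν) (⋃ i, S i) := measure_mono hcover
    _ ≤ ∑ i, Measure.pi (fun _ : Fin (n + 1) => ν) (S i) := measure_iUnion_fintype_le _ _
    _ = _ := by simp [hS]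

theorem measure_pow_le_setLIntegral_sublevel_pow {Ω α : Type*} [MeasurableSpace Ω]
    [LinearOrder α] [TopologicalSpace α] [OrderClosedTopology α] [SecondCountableTopology α]
    [MeasurableSpace α] [OpensMeasurableSpace α]
    (ν : Measure Ω) [SigmaFinite ν] {ρ : Ω → α} (hρ : Measurable ρ) (s : Set Ω) (n : ℕ) :
    ν s ^ (n + 1) ≤ (n + 1) * ∫⁻ z in s, ν {w | ρ w ≤ ρ z} ^ n ∂ν := by
  have h := measure_univ_pow_le_lintegral_sublevel_pow (ν.restrict s) hρ n
  rw [Measure.restrict_apply_univ] at h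
  refine h.trans ?_
  gcongr
  exact Measure.restrict_le_self

namespace IsQuasiMetricKernel

variable {Ω : Type*} [MeasurableSpace Ω] {K : Ω → Ω → ℝ≥0∞} {κ : ℝ≥0}

theorem inv_le_max (hK : IsQuasiMetricKernel K κ) (x y z : Ω) :
    (K x y)⁻¹ ≤ 2 * κ * max (K x z)⁻¹ (K z y)⁻¹ := by
  refine (hK.tri x y z).trans ?_
  rw [mul_comm 2, mul_assoc, two_mul]
  gcongr
  · exact le_max_left _ _
  · exact le_max_right _ _

theorem one_le_four_mul_sq (hK : IsQuasiMetricKernel K κ) {x y : Ω} (hxy : K x y ≠ ∞) :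
    (1 : ℝ≥0∞) ≤ 4 * (κ : ℝ≥0∞) ^ 2 := by
  by_contra! hlt
  have hκ : 2 * κ < 1 := by
    have h : 4 * κ ^ 2 < 1 := by exact_mod_cast hlt
    by_contra! h'
    have := mul_le_mul' h' h'
    ring_nf at this h
    exact absurd h (by simpa [mul_comm] using not_lt.2 this)
  have hd0 : (K x y)⁻¹ ≠ 0 := ENNReal.inv_ne_zero.2 hxy
  have hd1 : (K x y)⁻¹ ≠ ∞ := ENNReal.inv_ne_top.2 (hK.pos x y)
  have hκ' : 2 * (κ : ℝ≥0∞) < 1 := by exact_mod_cast hκ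
  have hxx : (K x x)⁻¹ ≤ (K x y)⁻¹ := by
    have h := hK.inv_le_max x x y
    rw [hK.symm y x, max_self] at h
    exact h.trans (mul_le_of_le_one_left' hκ'.le)
  have h := hK.inv_le_max x y x
  rw [max_eq_right hxx] at h
  exact absurd h (not_le.2 (by simpa using ENNReal.mul_lt_mul_left hd0 hd1 hκ'))

/-- A Ptolemy-type inequality for quasi-metrics. -/
theorem inv_mul_inv_le_max (hK : IsQuasiMetricKernel K κ) (x y z w : Ω) :
    (K x y)⁻¹ * (K z w)⁻¹ ≤
      4 * (κ : ℝ≥0∞) ^ 2 * max ((K x w)⁻¹ * (K z y)⁻¹) ((K x z)⁻¹ * (K w y)⁻¹) := by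
  have h1 := hK.inv_le_max x y z
  have h2 := hK.inv_le_max x y w
  have h3 := hK.inv_le_max z w x
  have h4 := hK.inv_le_max z w y
  rw [hK.symm z x] at h3
  rw [hK.symm y w] at h4
  generalize (K x w)⁻¹ = a at *
  generalize (K z y)⁻¹ = b at *
  generalize (K x z)⁻¹ = c at *
  generalize (K w y)⁻¹ = e at *
  have key : ∀ p q : ℝ≥0∞, (K x y)⁻¹ ≤ 2 * κ * p → (K z w)⁻¹ ≤ 2 * κ * q →
      p * q ≤ max (a * b) (c * e) →
      (K x y)⁻¹ * (K z w)⁻¹ ≤ 4 * (κ : ℝ≥0∞) ^ 2 * max (a * b) (c * e) := by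
    intro p q hp hq hpq
    calc (K x y)⁻¹ * (K z w)⁻¹ ≤ (2 * κ * p) * (2 * κ * q) := mul_le_mul' hp hq
      _ = 4 * (κ : ℝ≥0∞) ^ 2 * (p * q) := by ring
      _ ≤ _ := by gcongr
  have bound : ∀ a b c e : ℝ≥0∞, b ≤ a → c ≤ a → e ≤ a →
      max c b * max b e ≤ max (a * b) (c * e) := by
    intro a b c e hb hc he
    rcases le_total c b with hcb | hcb
    · rw [max_eq_right hcb, mul_comm]
      exact le_max_of_le_left (mul_le_mul' (max_le hb he) le_rfl)
    · rw [max_eq_left hcb]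
      rcases le_total b e with hbe | hbe
      · rw [max_eq_right hbe]
        exact le_max_right _ _
      · rw [max_eq_left hbe]
        exact le_max_of_le_left (mul_le_mul' hc le_rfl)
  rcases le_total a b with hab | hab <;> rcases le_total c e with hce | hce
  · rcases le_total b e with hbe | hbe
    · exact key _ _ h1 h3 (by
        have := bound e c b a hce hbe (hab.trans hbe)
        rwa [max_comm b c, max_comm (e * c), mul_comm b a, mul_comm e c] at this)
    · exact key _ _ h2 h3 (by
        have := bound b a e c hab hbe (hce.trans hbe)
        rwa [max_comm e a, max_comm a c, mul_comm b a, mul_comm e c] at this)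
  · rcases le_total b c with hbc | hbc
    · exact key _ _ h2 h4 (by
        have := bound c e a b hce (hab.trans hbc) hbc
        rwa [max_comm e b, max_comm (c * e)] at this)
    · exact key _ _ h2 h3 (by
        have := bound b a e c hab (hce.trans hbc) hbc
        rwa [max_comm e a, max_comm a c, mul_comm b a, mul_comm e c] at this)
  · rcases le_total a e with hae | hae
    · exact key _ _ h1 h3 (by
        have := bound e c b a hce (hab.trans hae) hae
        rwa [max_comm b c, max_comm (e * c), mul_comm b a, mul_comm e c] at this)
    · exact key _ _ h1 h4 (bound a b c e hab (hce.trans hae) hae)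
  · rcases le_total a c with hac | hac
    · exact key _ _ h2 h4 (by
        have := bound c e a b hce hac (hab.trans hac)
        rwa [max_comm e b, max_comm (c * e)] at this)
    · exact key _ _ h1 h4 (bound a b c e hab hac (hce.trans hac))

theorem mul_le_mul_of_ratio_le (hK : IsQuasiMetricKernel K κ) (hκ : 0 < κ) {x y z w : Ω}
    (hxy : K x y ≠ ∞) (hzw : (K x z)⁻¹ / (K z y)⁻¹ ≤ (K x w)⁻¹ / (K w y)⁻¹) :
    (4 * (κ : ℝ≥0∞) ^ 2)⁻¹ * (K x w * (K z y / K x y)) ≤ K z w := by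
  have top (u v : Ω) : (K u v)⁻¹ ≠ ∞ := ENNReal.inv_ne_top.2 (hK.pos u v)
  have hprod : (K x z)⁻¹ * (K w y)⁻¹ ≤ (K x w)⁻¹ * (K z y)⁻¹ := by
    by_cases he : (K w y)⁻¹ = 0
    · simp [he]
    by_cases hb : (K z y)⁻¹ = 0
    · have hc : (K x z)⁻¹ ≠ 0 := by
        intro hc
        have := hK.tri x y z
        rw [hb, hc] at this
        simp [hxy] at this
      rw [hb, ENNReal.div_zero hc, top_le_iff] at hzw
      exact absurd hzw (ENNReal.div_ne_top (top x w) he)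
    · rwa [ENNReal.div_le_iff hb (top z y), mul_comm, ← mul_div_assoc,
        ENNReal.le_div_iff_mul_le (Or.inl he) (Or.inl (top w y)),
        mul_comm (K z y)⁻¹] at hzw
  have h := hK.inv_mul_inv_le_max x y z w
  rw [max_eq_left hprod] at h
  have h' := ENNReal.inv_le_inv.2 h
  have hC0 : 4 * (κ : ℝ≥0∞) ^ 2 ≠ 0 := by simp [hκ.ne']
  have hC1 : 4 * (κ : ℝ≥0∞) ^ 2 ≠ ∞ := by finiteness
  rw [ENNReal.mul_inv (Or.inl hC0) (Or.inl hC1),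
    ENNReal.mul_inv (Or.inr (top _ _)) (Or.inl (top _ _)),
    ENNReal.mul_inv (Or.inr (top _ _)) (Or.inl (top _ _))] at h'
  simp only [inv_inv] at h'
  calc _ = (4 * (κ : ℝ≥0∞) ^ 2)⁻¹ * (K x w * K z y) / K x y := by
        simp only [div_eq_mul_inv, mul_assoc]
    _ ≤ K x y * K z w / K x y := by gcongr
    _ = K z w := by rw [mul_comm, ENNReal.mul_div_cancel_right (hK.pos x y) hxy]

theorem measurable_left (hK : IsQuasiMetricKernel K κ) (x : Ω) : Measurable (K x) :=
  hK.measurable.comp measurable_prodMk_left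

theorem measurable_right (hK : IsQuasiMetricKernel K κ) (y : Ω) : Measurable fun x => K x y :=
  hK.measurable.comp measurable_prodMk_right

/-- The measure `K(x,z) K(z,y) / K(x,y) dω(z)`, of total mass `K₂(x,y) / K(x,y)`. -/
noncomputable def bridgeMeasure (K : Ω → Ω → ℝ≥0∞) (ω : Measure Ω) (x y : Ω) : Measure Ω :=
  ω.withDensity fun z => K x z * (K z y / K x y)

/-- The ratio `d(x,z) / d(z,y)` of the quasi-distances of `z` to `x` and `y`. -/
noncomputable def ratio (K : Ω → Ω → ℝ≥0∞) (x y z : Ω) : ℝ≥0∞ :=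
  (K x z)⁻¹ / (K z y)⁻¹

theorem bridgeMeasure_univ (hK : IsQuasiMetricKernel K κ) (ω : Measure Ω) (x y : Ω) :
    bridgeMeasure K ω x y Set.univ = Kiter ω K 1 x y / K x y := by
  rw [bridgeMeasure, withDensity_apply _ MeasurableSet.univ, Measure.restrict_univ]
  simp only [Kiter, div_eq_mul_inv, ← mul_assoc]
  exact lintegral_mul_const _ ((hK.measurable_left x).mul (hK.measurable_right y))

theorem measurable_ratio (hK : IsQuasiMetricKernel K κ) (x y : Ω) : Measurable (ratio K x y) :=
  (hK.measurable_left x).inv.div (hK.measurable_right y).inv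

/-- A lower bound for `Kiter ω K n x` on `s` yields one for `Kiter ω K (n + 1) x`. -/
theorem mul_measure_pow_le_Kiter_succ (hK : IsQuasiMetricKernel K κ) (ω : Measure Ω) {x y : Ω}
    [SigmaFinite (bridgeMeasure K ω x y)] {s : Set Ω} (hs : MeasurableSet s) {n : ℕ}
    {a q : ℝ≥0∞} {w : Ω}
    (ha : ∀ z ∈ s, a * (n.factorial : ℝ≥0∞)⁻¹ * K x z *
      bridgeMeasure K ω x y {v | ratio K x y v ≤ ratio K x y z} ^ n ≤ Kiter ω K n x z)
    (hq : ∀ z ∈ s, q * (K z y / K x y) ≤ K z w) :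
    a * q * ((n + 1).factorial : ℝ≥0∞)⁻¹ * bridgeMeasure K ω x y s ^ (n + 1) ≤
      Kiter ω K (n + 1) x w := by
  have hG : Measurable fun z => bridgeMeasure K ω x y {v | ratio K x y v ≤ ratio K x y z} :=
    Monotone.measurable (f := fun t => bridgeMeasure K ω x y {v | ratio K x y v ≤ t})
      (fun s t hst => measure_mono fun v (hv : ratio K x y v ≤ s) => hv.trans hst)
      |>.comp (hK.measurable_ratio x y)
  have hfact : ((n + 1).factorial : ℝ≥0∞)⁻¹ * (n + 1) = (n.factorial : ℝ≥0∞)⁻¹ := by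
    rw [Nat.factorial_succ, Nat.cast_mul,
      ENNReal.mul_inv (Or.inl (by simp)) (Or.inl (ENNReal.natCast_ne_top _)), mul_right_comm,
      Nat.cast_add_one, ENNReal.inv_mul_cancel (by simp) (by finiteness), one_mul]
  set μ := bridgeMeasure K ω x y with hμ
  calc a * q * ((n + 1).factorial : ℝ≥0∞)⁻¹ * μ s ^ (n + 1)
      ≤ a * q * ((n + 1).factorial : ℝ≥0∞)⁻¹ *
        ((n + 1) * ∫⁻ z in s, μ {v | ratio K x y v ≤ ratio K x y z} ^ n ∂μ) := by
        gcongr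
        exact measure_pow_le_setLIntegral_sublevel_pow μ (hK.measurable_ratio x y) s n
    _ = a * q * (((n + 1).factorial : ℝ≥0∞)⁻¹ * (n + 1)) *
        ∫⁻ z in s, μ {v | ratio K x y v ≤ ratio K x y z} ^ n ∂μ := by ring
    _ = a * q * (n.factorial : ℝ≥0∞)⁻¹ * ∫⁻ z in s, K x z * (K z y / K x y) *
        μ {v | ratio K x y v ≤ ratio K x y z} ^ n ∂ω := by
        rw [hfact]
        congr 1
        exact setLIntegral_withDensity_eq_setLIntegral_mul _
          ((hK.measurable_left x).mul ((hK.measurable_right y).div_const _)) (hG.pow_const n) hs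
    _ ≤ ∫⁻ z in s, a * q * (n.factorial : ℝ≥0∞)⁻¹ * (K x z * (K z y / K x y) *
        μ {v | ratio K x y v ≤ ratio K x y z} ^ n) ∂ω := lintegral_const_mul_le _ _
    _ ≤ ∫⁻ z in s, Kiter ω K n x z * K z w ∂ω := by
        refine setLIntegral_mono' hs fun z hz => ?_
        calc _ = (a * (n.factorial : ℝ≥0∞)⁻¹ * K x z *
              μ {v | ratio K x y v ≤ ratio K x y z} ^ n) * (q * (K z y / K x y)) := by ring
          _ ≤ _ := mul_le_mul' (ha z hz) (hq z hz)
    _ ≤ Kiter ω K (n + 1) x w := setLIntegral_le_lintegral _ _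

theorem mul_sublevel_pow_le_Kiter (hK : IsQuasiMetricKernel K κ) (hκ : 0 < κ)
    (ω : Measure Ω) {x y : Ω} (hxy : K x y ≠ ∞) [SigmaFinite (bridgeMeasure K ω x y)]
    (n : ℕ) (w : Ω) :
    (4 * (κ : ℝ≥0∞) ^ 2)⁻¹ ^ n * (n.factorial : ℝ≥0∞)⁻¹ * K x w *
      bridgeMeasure K ω x y {v | ratio K x y v ≤ ratio K x y w} ^ n ≤ Kiter ω K n x w := by
  induction n generalizing w with
  | zero => simp [Kiter]
  | succ n ih =>
    refine le_trans (le_of_eq ?_) (hK.mul_measure_pow_le_Kiter_succ ω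
      (s := {v | ratio K x y v ≤ ratio K x y w})
      (measurableSet_le (hK.measurable_ratio x y) measurable_const) (fun z _ => ih z)
      (q := (4 * (κ : ℝ≥0∞) ^ 2)⁻¹ * K x w) (fun z hz => ?_))
    · ring
    · rw [mul_assoc]
      exact hK.mul_le_mul_of_ratio_le hκ hxy hz

end IsQuasiMetricKernel

theorem eexp_eq_tsum {t : ℝ≥0∞} (ht : t ≠ ∞) :
    eexp t = ∑' n : ℕ, t ^ n * (n.factorial : ℝ≥0∞)⁻¹ := by
  lift t to ℝ≥0 using ht
  rw [eexp, if_neg coe_ne_top, coe_toReal]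
  have hs : HasSum (fun n : ℕ => (t : ℝ) ^ n / n.factorial) (Real.exp t) := by
    rw [Real.exp_eq_exp_ℝ]
    exact NormedSpace.expSeries_div_hasSum_exp (t : ℝ)
  rw [← hs.tsum_eq, ENNReal.ofReal_tsum_of_nonneg (fun n => by positivity) hs.summable]
  refine tsum_congr fun n => ?_
  rw [ENNReal.ofReal_div_of_pos (by positivity), ENNReal.ofReal_pow (by positivity)]
  simp [div_eq_mul_inv]

/-- for a quasi-metric kernel `K` with constant `κ`, the Green's
function `H(x,y) = Σ_{j=1}^∞ K_j(x,y)` satisfies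
`H(x,y) ≥ K(x,y)·exp(c·K₂(x,y)/K(x,y))` with `c = (4κ²)⁻¹`. -/
theorem green_function_lower_bound {Ω : Type*} [MeasurableSpace Ω]
    (ω : Measure Ω) [SigmaFinite ω] (K : Ω → Ω → ℝ≥0∞) (κ : ℝ≥0)
    (hκ : 0 < κ) (hK : IsQuasiMetricKernel K κ) (x y : Ω) :
    K x y * eexp ((4 * (κ : ℝ≥0∞) ^ 2)⁻¹ * (Kiter ω K 1 x y / K x y)) ≤
      ∑' j : ℕ, Kiter ω K j x y := by
  by_cases hxy : K x y = ∞
  · have h : Kiter ω K 0 x y = ∞ := hxy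
    rw [ENNReal.tsum_eq_top_of_eq_top ⟨0, h⟩]
    exact le_top
  by_cases h2 : Kiter ω K 1 x y = ∞
  · rw [ENNReal.tsum_eq_top_of_eq_top ⟨1, h2⟩]
    exact le_top
  have hm : Kiter ω K 1 x y / K x y ≠ ∞ := ENNReal.div_ne_top h2 (hK.pos x y)
  rw [← hK.bridgeMeasure_univ] at hm ⊢
  have : IsFiniteMeasure (IsQuasiMetricKernel.bridgeMeasure K ω x y) := ⟨hm.lt_top⟩
  have hbound := hK.mul_sublevel_pow_le_Kiter hκ ω hxy
  have hc : (4 * (κ : ℝ≥0∞) ^ 2)⁻¹ ≤ 1 := ENNReal.inv_le_one.2 (hK.one_le_four_mul_sq hxy)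
  generalize (4 * (κ : ℝ≥0∞) ^ 2)⁻¹ = c at *
  rw [eexp_eq_tsum (ENNReal.mul_ne_top (ne_top_of_le_ne_top one_ne_top hc) hm),
    ← ENNReal.tsum_mul_left]
  refine ENNReal.tsum_le_tsum fun n => ?_
  cases n with
  | zero => simp [Kiter]
  | succ n =>
    refine le_trans ?_ (hK.mul_measure_pow_le_Kiter_succ ω MeasurableSet.univ
      (fun z _ => hbound n z) (q := K x y) (fun z _ => ?_))
    · rw [mul_pow, pow_succ c, mul_comm (c ^ n) (K x y)]
      calc _ = c * (K x y * c ^ n * ((n + 1).factorial : ℝ≥0∞)⁻¹ *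
            IsQuasiMetricKernel.bridgeMeasure K ω x y Set.univ ^ (n + 1)) := by ring
        _ ≤ _ := mul_le_of_le_one_left' hc
    · rw [ENNReal.mul_div_cancel (hK.pos x y) hxy]
end

section
/- Let (Ω, ω) be a σ-finite measure space and K a quasi-metric kernel with constant κ on Ω. Then for all x, y ∈ Ω: K₂(x,y) ≤ κ · K(x,y) · ( T1(x) + T1(y) ), where K₂(x,y) = ∫_Ω K(x,z) K(z,y) dω(z) and T1(x) = ∫_Ω K(x,z) dω(z). In particular, if T1 is bounded by a constant M, then K₂(x,y) ≤ 2κM · K(x,y) for all x, y. -/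
open MeasureTheory ENNReal
open scoped NNReal

/-- The quasi-triangle inequality for `1 / K`, with denominators cleared. -/
lemma ENNReal.mul_le_mul_add_of_inv_le {a b c k : ℝ≥0∞} (ha : a ≠ 0) (hb : b ≠ 0)
    (hc : c ≠ 0) (hk : k ≠ 0) (h : c⁻¹ ≤ k * (a⁻¹ + b⁻¹)) :
    a * b ≤ k * c * (a + b) := by
  have hkc : k * c ≠ 0 := mul_ne_zero hk hc
  have hab : a + b ≠ 0 := by simp [ha]
  by_cases hct : c = ∞
  · simp [hct, ENNReal.mul_top hk, ENNReal.top_mul hab]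
  by_cases hat : a = ∞
  · simp [hat, ENNReal.mul_top hkc]
  by_cases hbt : b = ∞
  · simp [hbt, ENNReal.mul_top hkc]
  calc a * b = a * b * c * c⁻¹ := by
        rw [mul_assoc, ENNReal.mul_inv_cancel hc hct, mul_one]
    _ ≤ a * b * c * (k * (a⁻¹ + b⁻¹)) := by gcongr
    _ = k * c * (a * a⁻¹ * b + b * b⁻¹ * a) := by ring
    _ = k * c * (a + b) := by
        rw [ENNReal.mul_inv_cancel ha hat, ENNReal.mul_inv_cancel hb hbt, one_mul, one_mul,
          add_comm b a]

/-- for a quasi-metric kernel `K` with constant `κ`,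
`K₂(x,y) ≤ κ·K(x,y)·(T1(x) + T1(y))` where
`K₂(x,y) = ∫ K(x,z) K(z,y) dω(z)` and `T1(x) = ∫ K(x,z) dω(z)`.
In particular, if `T1 ≤ M` everywhere then `K₂(x,y) ≤ 2κM·K(x,y)`. -/
theorem K2_le_of_T1 {Ω : Type*} [MeasurableSpace Ω]
    (ω : Measure Ω) [SigmaFinite ω] (K : Ω → Ω → ℝ≥0∞) (κ : ℝ≥0)
    (hκ : 0 < κ) (hK : IsQuasiMetricKernel K κ) :
    (∀ x y, (∫⁻ z, K x z * K z y ∂ω) ≤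
        (κ : ℝ≥0∞) * K x y * ((∫⁻ z, K x z ∂ω) + (∫⁻ z, K y z ∂ω))) ∧
    ∀ M : ℝ≥0, (∀ x, (∫⁻ z, K x z ∂ω) ≤ M) →
      ∀ x y, (∫⁻ z, K x z * K z y ∂ω) ≤ 2 * (κ : ℝ≥0∞) * M * K x y := by
  have hK₂ : ∀ x y, (∫⁻ z, K x z * K z y ∂ω) ≤
      (κ : ℝ≥0∞) * K x y * ((∫⁻ z, K x z ∂ω) + (∫⁻ z, K y z ∂ω)) := by
    intro x y
    have hm : ∀ x, Measurable (K x) := fun x => hK.measurable.comp measurable_prodMk_left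
    have hadd : Measurable fun z => K x z + K y z := (hm x).add (hm y)
    rw [← lintegral_add_left (hm x), ← lintegral_const_mul _ hadd]
    refine lintegral_mono fun z => ?_
    rw [hK.symm y z]
    exact ENNReal.mul_le_mul_add_of_inv_le (hK.pos x z) (hK.pos z y) (hK.pos x y)
      (by exact_mod_cast hκ.ne') (hK.tri x y z)
  refine ⟨hK₂, fun M hM x y => (hK₂ x y).trans ?_⟩
  calc (κ : ℝ≥0∞) * K x y * ((∫⁻ z, K x z ∂ω) + (∫⁻ z, K y z ∂ω))
      ≤ (κ : ℝ≥0∞) * K x y * (M + M) := by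
        gcongr
        · exact hM x
        · exact hM y
    _ = 2 * (κ : ℝ≥0∞) * M * K x y := by ring
end

section
/- Let (Ω, ω) be a σ-finite measure space and K a quasi-metric kernel with constant κ on Ω, with K not identically +∞. Let T be the associated integral operator, K_j the iterated kernels, and u₀ = 1 + Σ_{j=1}^∞ T^j 1 the minimal positive solution of u = Tu + 1. Then the following are equivalent: (a) there exists C₁ > 0 such that Σ_{j=1}^∞ K_j(x,y) ≤ C₁ · K(x,y) for all x, y ∈ Ω; (b) ‖T‖_{L²(ω)→L²(ω)} < 1 and there exists C₂ > 0 with K₂(x,y) ≤ C₂ · K(x,y) for all x, y ∈ Ω; (c) sup_{x ∈ Ω} u₀(x) < +∞. -/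
open MeasureTheory ENNReal
open scoped NNReal

/-- The integral operator `Tf(x) = ∫ K(x,y) f(y) dω(y)`. -/
noncomputable def Tapp {Ω : Type*} [MeasurableSpace Ω] (ω : Measure Ω)
    (K : Ω → Ω → ℝ≥0∞) (f : Ω → ℝ≥0∞) : Ω → ℝ≥0∞ :=
  fun x => ∫⁻ y, K x y * f y ∂ω

section Basics

variable {Ω : Type*} [MeasurableSpace Ω] {ν μ : Measure Ω} {K : Ω → Ω → ℝ≥0∞}

lemma measurable_Tapp [SFinite ν] (hK : Measurable fun p : Ω × Ω => K p.1 p.2)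
    {f : Ω → ℝ≥0∞} (hf : Measurable f) : Measurable (Tapp ν K f) :=
  Measurable.lintegral_prod_right' (f := fun p : Ω × Ω => K p.1 p.2 * f p.2)
    (hK.mul (hf.comp measurable_snd))

lemma Tapp_mono {f g : Ω → ℝ≥0∞} (h : f ≤ g) : Tapp ν K f ≤ Tapp ν K g :=
  fun _ => lintegral_mono fun y => mul_le_mul_right (h y) _

lemma Tapp_mono_measure (h : μ ≤ ν) (f : Ω → ℝ≥0∞) : Tapp μ K f ≤ Tapp ν K f :=
  fun _ => lintegral_mono' h le_rfl

lemma measurable_kernel_right (hK : Measurable fun p : Ω × Ω => K p.1 p.2) (x : Ω) :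
    Measurable (K x) :=
  hK.comp measurable_prodMk_left

lemma Tapp_add (hK : Measurable fun p : Ω × Ω => K p.1 p.2)
    {f : Ω → ℝ≥0∞} (hf : Measurable f) (g : Ω → ℝ≥0∞) :
    Tapp ν K (f + g) = Tapp ν K f + Tapp ν K g := by
  funext x
  simp only [Tapp, Pi.add_apply, mul_add]
  exact lintegral_add_left ((measurable_kernel_right hK x).mul hf) _

lemma Tapp_const_mul (hK : Measurable fun p : Ω × Ω => K p.1 p.2)
    {f : Ω → ℝ≥0∞} (hf : Measurable f) (c : ℝ≥0∞) :
    Tapp ν K (fun x => c * f x) = fun x => c * Tapp ν K f x := by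
  funext x
  simp only [Tapp]
  rw [← lintegral_const_mul (f := fun y => K x y * f y) _
    ((measurable_kernel_right hK x).mul hf)]
  exact lintegral_congr fun y => by ring

lemma Tapp_tsum (hK : Measurable fun p : Ω × Ω => K p.1 p.2)
    {f : ℕ → Ω → ℝ≥0∞} (hf : ∀ j, Measurable (f j)) :
    Tapp ν K (fun x => ∑' j, f j x) = fun x => ∑' j, Tapp ν K (f j) x := by
  funext x
  simp only [Tapp, ← ENNReal.tsum_mul_left]
  exact lintegral_tsum fun j => ((measurable_kernel_right hK x).mul (hf j)).aemeasurable

lemma Tapp_add_measure (f : Ω → ℝ≥0∞) :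
    Tapp (μ + ν) K f = Tapp μ K f + Tapp ν K f := by
  funext x
  simp [Tapp, lintegral_add_measure]

/-- Symmetry of the operator, with respect to two possibly different measures. -/
lemma lintegral_Tapp_mul [SFinite ν] [SFinite μ]
    (hK : Measurable fun p : Ω × Ω => K p.1 p.2) (hs : ∀ x y, K x y = K y x)
    {f g : Ω → ℝ≥0∞} (hf : Measurable f) (hg : Measurable g) :
    ∫⁻ x, Tapp μ K f x * g x ∂ν = ∫⁻ y, f y * Tapp ν K g y ∂μ := by
  have h1 : ∀ x, Tapp μ K f x * g x = ∫⁻ y, K x y * f y * g x ∂μ := fun x =>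
    (lintegral_mul_const _ ((measurable_kernel_right hK x).mul hf)).symm
  have h2 : ∀ y, f y * Tapp ν K g y = ∫⁻ x, f y * (K y x * g x) ∂ν := fun y =>
    (lintegral_const_mul _ ((measurable_kernel_right hK y).mul hg)).symm
  simp only [h1, h2]
  rw [lintegral_lintegral_swap]
  · refine lintegral_congr fun y => lintegral_congr fun x => ?_
    rw [hs x y]; ring
  · exact ((hK.mul (hf.comp measurable_snd)).mul (hg.comp measurable_fst)).aemeasurable

lemma measurable_Tapp_iterate [SFinite ν] (hK : Measurable fun p : Ω × Ω => K p.1 p.2)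
    {f : Ω → ℝ≥0∞} (hf : Measurable f) (j : ℕ) : Measurable ((Tapp ν K)^[j] f) := by
  induction j with
  | zero => exact hf
  | succ j ih => rw [Function.iterate_succ_apply']; exact measurable_Tapp hK ih

lemma Tapp_iterate_mono {f g : Ω → ℝ≥0∞} (h : f ≤ g) (j : ℕ) :
    (Tapp ν K)^[j] f ≤ (Tapp ν K)^[j] g := by
  induction j with
  | zero => exact h
  | succ j ih => simp only [Function.iterate_succ_apply']; exact Tapp_mono ih

lemma Tapp_iterate_mono_measure (h : μ ≤ ν) (f : Ω → ℝ≥0∞) (j : ℕ) :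
    (Tapp μ K)^[j] f ≤ (Tapp ν K)^[j] f := by
  induction j with
  | zero => exact le_rfl
  | succ j ih =>
    simp only [Function.iterate_succ_apply']
    exact (Tapp_mono ih).trans (Tapp_mono_measure h _)

lemma Tapp_iterate_add [SFinite ν] (hK : Measurable fun p : Ω × Ω => K p.1 p.2)
    {f : Ω → ℝ≥0∞} (hf : Measurable f) (g : Ω → ℝ≥0∞) (j : ℕ) :
    (Tapp ν K)^[j] (f + g) = (Tapp ν K)^[j] f + (Tapp ν K)^[j] g := by
  induction j with
  | zero => rfl
  | succ j ih =>
    simp only [Function.iterate_succ_apply', ih]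
    exact Tapp_add hK (measurable_Tapp_iterate hK hf j) _

lemma lintegral_Tapp_iterate_mul [SFinite ν]
    (hK : Measurable fun p : Ω × Ω => K p.1 p.2) (hs : ∀ x y, K x y = K y x)
    {f g : Ω → ℝ≥0∞} (hf : Measurable f) (hg : Measurable g) (j : ℕ) :
    ∫⁻ x, (Tapp ν K)^[j] f x * g x ∂ν = ∫⁻ x, f x * (Tapp ν K)^[j] g x ∂ν := by
  induction j generalizing g with
  | zero => rfl
  | succ j ih =>
    rw [Function.iterate_succ_apply', Function.iterate_succ_apply,
      lintegral_Tapp_mul hK hs (measurable_Tapp_iterate hK hf j) hg,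
      ih (measurable_Tapp hK hg)]

/-- The Neumann series `∑ T^j f`. -/
noncomputable def neumann (ν : Measure Ω) (K : Ω → Ω → ℝ≥0∞) (f : Ω → ℝ≥0∞) : Ω → ℝ≥0∞ :=
  fun x => ∑' j, (Tapp ν K)^[j] f x

lemma measurable_neumann [SFinite ν] (hK : Measurable fun p : Ω × Ω => K p.1 p.2)
    {f : Ω → ℝ≥0∞} (hf : Measurable f) : Measurable (neumann ν K f) :=
  Measurable.tsum fun j => measurable_Tapp_iterate hK hf j

lemma neumann_eq [SFinite ν] (hK : Measurable fun p : Ω × Ω => K p.1 p.2)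
    {f : Ω → ℝ≥0∞} (hf : Measurable f) :
    neumann ν K f = f + Tapp ν K (neumann ν K f) := by
  unfold neumann
  rw [Tapp_tsum hK fun j => measurable_Tapp_iterate hK hf j]
  funext x
  rw [tsum_eq_zero_add' ENNReal.summable]
  simp [Function.iterate_succ_apply']

lemma neumann_add [SFinite ν] (hK : Measurable fun p : Ω × Ω => K p.1 p.2)
    {f : Ω → ℝ≥0∞} (hf : Measurable f) (g : Ω → ℝ≥0∞) :
    neumann ν K (f + g) = neumann ν K f + neumann ν K g := by
  funext x
  simp only [neumann, Tapp_iterate_add hK hf, Pi.add_apply]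
  exact ENNReal.tsum_add

lemma neumann_mono_measure (h : μ ≤ ν) (f : Ω → ℝ≥0∞) : neumann μ K f ≤ neumann ν K f :=
  fun x => ENNReal.tsum_le_tsum fun j => Tapp_iterate_mono_measure h f j x

end Basics

section L2

variable {Ω : Type*} [MeasurableSpace Ω] {ν μ : Measure Ω} {K : Ω → Ω → ℝ≥0∞}

/-- The `L²` norm of a nonnegative function. -/
noncomputable def l2norm (ν : Measure Ω) (f : Ω → ℝ≥0∞) : ℝ≥0∞ :=
  (∫⁻ x, f x ^ 2 ∂ν) ^ (1 / 2 : ℝ)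

lemma l2norm_mono {f g : Ω → ℝ≥0∞} (h : f ≤ g) : l2norm ν f ≤ l2norm ν g :=
  ENNReal.rpow_le_rpow (lintegral_mono fun x => pow_le_pow_left' (h x) 2) (by norm_num)

lemma l2norm_add_le {f g : Ω → ℝ≥0∞} (hf : Measurable f) (hg : Measurable g) :
    l2norm ν (f + g) ≤ l2norm ν f + l2norm ν g := by
  have := ENNReal.lintegral_Lp_add_le (μ := ν) hf.aemeasurable hg.aemeasurable
    (p := 2) (by norm_num)
  simpa only [l2norm, ENNReal.rpow_two] using this

lemma lintegral_mul_le_l2norm {f g : Ω → ℝ≥0∞} (hf : Measurable f) (hg : Measurable g) :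
    ∫⁻ x, f x * g x ∂ν ≤ l2norm ν f * l2norm ν g := by
  have := ENNReal.lintegral_mul_le_Lp_mul_Lq ν (p := 2) (q := 2)
    (Real.holderConjugate_iff.mpr (by norm_num)) hf.aemeasurable hg.aemeasurable
  simpa only [l2norm, ENNReal.rpow_two, Pi.mul_apply] using this

lemma l2norm_const_mul {f : Ω → ℝ≥0∞} (hf : Measurable f) (c : ℝ≥0∞) :
    l2norm ν (fun x => c * f x) = c * l2norm ν f := by
  simp only [l2norm, mul_pow]
  rw [lintegral_const_mul _ (hf.pow_const 2), ENNReal.mul_rpow_of_nonneg _ _ (by norm_num),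
    ← ENNReal.rpow_natCast, ← ENNReal.rpow_mul]
  norm_num

lemma l2norm_const (c : ℝ≥0∞) :
    l2norm ν (fun _ => c) = c * (ν Set.univ) ^ (1 / 2 : ℝ) := by
  have := l2norm_const_mul (ν := ν) (f := fun _ => 1) measurable_const c
  simpa [l2norm] using this

lemma l2norm_sum_le {f : ℕ → Ω → ℝ≥0∞} (hf : ∀ j, Measurable (f j)) (n : ℕ) :
    l2norm ν (fun x => ∑ j ∈ Finset.range n, f j x) ≤
      ∑ j ∈ Finset.range n, l2norm ν (f j) := by
  induction n with
  | zero => simp [l2norm]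
  | succ n ih =>
    simp only [Finset.sum_range_succ]
    exact (l2norm_add_le (Finset.measurable_sum _ fun j _ => hf j) (hf n)).trans
      (add_le_add ih le_rfl)

lemma l2norm_tsum_le {f : ℕ → Ω → ℝ≥0∞} (hf : ∀ j, Measurable (f j)) :
    l2norm ν (fun x => ∑' j, f j x) ≤ ∑' j, l2norm ν (f j) := by
  have hmono : Monotone fun n x => ∑ j ∈ Finset.range n, f j x := fun m n h x =>
    Finset.sum_le_sum_of_subset (Finset.range_mono h)
  have h1 : ∫⁻ x, (∑' j, f j x) ^ 2 ∂ν =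
      ⨆ n, ∫⁻ x, (∑ j ∈ Finset.range n, f j x) ^ 2 ∂ν := by
    rw [← lintegral_iSup]
    · refine lintegral_congr fun x => ?_
      rw [ENNReal.tsum_eq_iSup_nat]
      exact ENNReal.iSup_pow _ 2
    · exact fun n => (Finset.measurable_sum _ fun j _ => hf j).pow_const 2
    · exact fun m n h x => pow_le_pow_left' (hmono h x) 2
  have h2 : ∫⁻ x, (∑' j, f j x) ^ 2 ∂ν ≤ (∑' j, l2norm ν (f j)) ^ (2 : ℝ) := by
    rw [h1]
    refine iSup_le fun n => ?_
    have := (l2norm_sum_le (ν := ν) hf n).trans (ENNReal.sum_le_tsum (Finset.range n))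
    rw [l2norm, one_div, ENNReal.rpow_inv_le_iff (by norm_num)] at this
    exact this
  rw [l2norm, one_div, ENNReal.rpow_inv_le_iff (by norm_num)]
  exact h2

/-- `T` has norm at most `q` on nonnegative functions in `L²(ν)`. -/
def L2Bound (ν : Measure Ω) (K : Ω → Ω → ℝ≥0∞) (q : ℝ≥0∞) : Prop :=
  ∀ f, Measurable f → l2norm ν (Tapp ν K f) ≤ q * l2norm ν f

lemma L2Bound.iterate [SFinite ν] {q : ℝ≥0∞} (h : L2Bound ν K q)
    (hK : Measurable fun p : Ω × Ω => K p.1 p.2) {f : Ω → ℝ≥0∞} (hf : Measurable f) (j : ℕ) :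
    l2norm ν ((Tapp ν K)^[j] f) ≤ q ^ j * l2norm ν f := by
  induction j with
  | zero => simp
  | succ j ih =>
    rw [Function.iterate_succ_apply', pow_succ', mul_assoc]
    exact (h _ (measurable_Tapp_iterate hK hf j)).trans (mul_le_mul_right ih _)

lemma L2Bound.neumann [SFinite ν] {q : ℝ≥0∞} (h : L2Bound ν K q)
    (hK : Measurable fun p : Ω × Ω => K p.1 p.2) {f : Ω → ℝ≥0∞} (hf : Measurable f) :
    l2norm ν (neumann ν K f) ≤ (1 - q)⁻¹ * l2norm ν f := by
  refine (l2norm_tsum_le fun j => measurable_Tapp_iterate hK hf j).trans ?_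
  rw [← ENNReal.tsum_geometric, ← ENNReal.tsum_mul_right]
  exact ENNReal.tsum_le_tsum fun j => h.iterate hK hf j

lemma Tapp_restrict {s : Set Ω} (hs : MeasurableSet s) (f : Ω → ℝ≥0∞) :
    Tapp (ν.restrict s) K f = Tapp ν K (s.indicator f) := by
  funext x
  simp only [Tapp]
  rw [← lintegral_indicator hs]
  refine lintegral_congr fun y => ?_
  by_cases hy : y ∈ s <;> simp [hy]

lemma l2norm_restrict {s : Set Ω} (hs : MeasurableSet s) (f : Ω → ℝ≥0∞) :
    l2norm (ν.restrict s) f = l2norm ν (s.indicator f) := by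
  simp only [l2norm]
  rw [← lintegral_indicator hs]
  congr 1
  refine lintegral_congr fun y => ?_
  by_cases hy : y ∈ s <;> simp [hy]

lemma L2Bound.restrict {q : ℝ≥0∞} (h : L2Bound ν K q) {s : Set Ω} (hs : MeasurableSet s) :
    L2Bound (ν.restrict s) K q := by
  intro f hf
  rw [Tapp_restrict hs, l2norm_restrict hs f, l2norm_restrict hs]
  exact (l2norm_mono (Set.indicator_le_self s _)).trans (h _ (hf.indicator hs))

lemma L2Bound_of_opNorm_lt {q : ℝ≥0} (h : opNorm ν K < q)
    (hK : Measurable fun p : Ω × Ω => K p.1 p.2) : L2Bound ν K q := by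
  have hq0 : (q : ℝ≥0∞) ≠ 0 := (zero_le.trans_lt h).ne'
  intro f hf
  rcases eq_or_ne (l2norm ν f) 0 with h0 | h0
  · have h1 : ∫⁻ x, f x ^ 2 ∂ν = 0 := by
      rw [l2norm, ENNReal.rpow_eq_zero_iff_of_pos (by norm_num)] at h0
      exact h0
    rw [lintegral_eq_zero_iff (hf.pow_const 2)] at h1
    have h2 : Tapp ν K f = fun _ => 0 := by
      funext x
      simp only [Tapp]
      rw [← lintegral_zero (μ := ν)]
      refine lintegral_congr_ae ?_
      filter_upwards [h1] with y hy
      have hy' : f y = 0 := by simpa using hy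
      simp [hy']
    rw [h2, l2norm_const]
    simp
  rcases eq_or_ne (l2norm ν f) ∞ with h1 | h1
  · rw [h1, ENNReal.mul_top hq0]; exact le_top
  set c := l2norm ν f with hc
  have hcf : Measurable fun x => c⁻¹ * f x := hf.const_mul _
  have hn : l2norm ν (fun x => c⁻¹ * f x) = 1 := by
    rw [l2norm_const_mul hf, ← hc, ENNReal.inv_mul_cancel h0 h1]
  have hn' : ∫⁻ y, (c⁻¹ * f y) ^ 2 ∂ν ≤ 1 := by
    rw [l2norm, one_div] at hn
    have := hn.le
    rw [ENNReal.rpow_inv_le_iff (by norm_num)] at this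
    simpa using this
  have hle : l2norm ν (Tapp ν K fun x => c⁻¹ * f x) ≤ q := by
    refine le_trans ?_ h.le
    exact le_iSup_of_le (fun x => c⁻¹ * f x) (le_iSup_of_le hcf (le_iSup_of_le hn' le_rfl))
  rw [Tapp_const_mul hK hf] at hle
  have hm : l2norm ν (fun x => c⁻¹ * Tapp ν K f x) = c⁻¹ * l2norm ν (Tapp ν K f) := by
    simp only [l2norm, mul_pow]
    rw [lintegral_const_mul' _ _ (by simp [h0]), ENNReal.mul_rpow_of_nonneg _ _ (by norm_num),
      ← ENNReal.rpow_natCast, ← ENNReal.rpow_mul]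
    norm_num
  rw [hm] at hle
  calc l2norm ν (Tapp ν K f) = c * (c⁻¹ * l2norm ν (Tapp ν K f)) := by
        rw [← mul_assoc, ENNReal.mul_inv_cancel h0 h1, one_mul]
    _ ≤ c * q := mul_le_mul_right hle _
    _ = q * c := mul_comm _ _

end L2

section ShortKernel

variable {Ω : Type*} {K : Ω → Ω → ℝ≥0∞}

/-- The part of the kernel `K` above the level `b`. -/
noncomputable def shortKernel (K : Ω → Ω → ℝ≥0∞) (b : ℝ≥0∞) (x y : Ω) : ℝ≥0∞ :=
  open Classical in if b < K x y then K x y else 0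

lemma shortKernel_le (b : ℝ≥0∞) (x y : Ω) : shortKernel K b x y ≤ K x y := by
  unfold shortKernel
  split_ifs
  · exact le_rfl
  · exact zero_le

lemma le_shortKernel_add (b : ℝ≥0∞) (x y : Ω) : K x y ≤ shortKernel K b x y + b := by
  unfold shortKernel
  split_ifs with h
  · exact le_self_add
  · simpa using h

end ShortKernel

section Decay

variable {Ω : Type*} [MeasurableSpace Ω] {ν μ : Measure Ω} {K : Ω → Ω → ℝ≥0∞}

lemma measurable_shortKernel (hK : Measurable fun p : Ω × Ω => K p.1 p.2) (b : ℝ≥0∞) :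
    Measurable fun p : Ω × Ω => shortKernel K b p.1 p.2 := by
  unfold shortKernel
  exact Measurable.ite (measurableSet_lt measurable_const hK) hK measurable_const

lemma L2Bound.shortKernel {q : ℝ≥0∞} (h : L2Bound ν K q) (b : ℝ≥0∞) :
    L2Bound ν (shortKernel K b) q := fun f hf =>
  (l2norm_mono fun x => lintegral_mono fun y =>
    mul_le_mul_left (shortKernel_le b x y) _).trans (h f hf)

/-- Powers of the short range operator are local. -/
lemma Tapp_shortKernel_iterate_congr {L : ℝ≥0∞} (hL : 1 ≤ L)
    (hQ : ∀ x y z, min (K x z) (K z y) ≤ L * K x y) {b : ℝ≥0∞} (i : ℕ)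
    {f f' : Ω → ℝ≥0∞} {y : Ω} (h : ∀ w, (w = y ∨ b < L ^ i * K y w) → f w = f' w) :
    (Tapp ν (shortKernel K b))^[i] f y = (Tapp ν (shortKernel K b))^[i] f' y := by
  induction i generalizing y with
  | zero => exact h y (Or.inl rfl)
  | succ i ih =>
    rw [Function.iterate_succ_apply', Function.iterate_succ_apply']
    refine lintegral_congr fun z => ?_
    by_cases hz : b < K y z
    · congr 1
      refine ih fun w hw => h w (Or.inr ?_)
      rcases hw with rfl | hw
      · exact hz.trans_le (le_mul_of_one_le_left zero_le (one_le_pow_of_one_le' hL _))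
      · have h1 : b < L ^ i * K y z :=
          hz.trans_le (le_mul_of_one_le_left zero_le (one_le_pow_of_one_le' hL _))
        have h2 : b < L ^ i * min (K y z) (K z w) := by
          rcases min_choice (K y z) (K z w) with h | h <;> rw [h] <;> assumption
        refine h2.trans_le ?_
        rw [pow_succ, mul_assoc]
        exact mul_le_mul_right (hQ y w z) _
    · simp [_root_.shortKernel, hz]

lemma l2norm_indicator_le_step [SFinite ν] [SFinite μ] (hμ : μ ≤ ν)
    (hK : Measurable fun p : Ω × Ω => K p.1 p.2) (hs : ∀ x y, K x y = K y x)
    {L : ℝ≥0∞} (hL : 1 ≤ L) (hQ : ∀ x y z, min (K x z) (K z y) ≤ L * K x y)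
    {q : ℝ≥0∞} (hq : q ≤ 1) (hb : L2Bound ν K q) (x₀ : Ω)
    {g : Ω → ℝ≥0∞} (hg : Measurable g) (hgle : ∀ y, g y ≤ K x₀ y + Tapp μ K g y)
    {m : ℝ≥0∞} (hm : 1 + ∫⁻ y, g y ∂μ ≤ m) (J : ℕ) (a : ℝ≥0∞) :
    l2norm ν ({y | K x₀ y ≤ a}.indicator g) ≤
      J * (L + L ^ (J + 1)) * m * a * (ν Set.univ) ^ (1 / 2 : ℝ) +
        q ^ J * l2norm ν ({y | K x₀ y ≤ L * a}.indicator g) := by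
  set b := L ^ (J + 1) * a with hbdef
  set S := Tapp ν (shortKernel K b) with hS
  have hSm := measurable_shortKernel hK b
  set h : Ω → ℝ≥0∞ := fun y => K x₀ y + m * b with hh
  have hhm : Measurable h := (measurable_kernel_right hK x₀).add_const _
  have h1m : 1 ≤ m := le_self_add.trans hm
  have h1 : g ≤ h + S g := by
    intro y
    refine (hgle y).trans ?_
    have : Tapp μ K g y ≤ S g y + m * b := by
      calc Tapp μ K g y ≤ ∫⁻ z, (shortKernel K b y z * g z + b * g z) ∂μ :=
            lintegral_mono fun z => by
              rw [← add_mul]; exact mul_le_mul_left (le_shortKernel_add b y z) _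
        _ = Tapp μ (shortKernel K b) g y + b * ∫⁻ z, g z ∂μ := by
            rw [lintegral_add_right _ (hg.const_mul b), lintegral_const_mul _ hg]; rfl
        _ ≤ S g y + b * m :=
            add_le_add (Tapp_mono_measure hμ g y)
              (mul_le_mul_right (le_add_self.trans hm) _)
        _ = S g y + m * b := by rw [mul_comm b]
    calc K x₀ y + Tapp μ K g y ≤ K x₀ y + (S g y + m * b) := add_le_add le_rfl this
      _ = (h + S g) y := by simp only [hh, Pi.add_apply]; ring
  have h2 : ∀ n y, g y ≤ (∑ i ∈ Finset.range n, S^[i] h y) + S^[n] g y := by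
    intro n
    induction n with
    | zero => intro y; simp
    | succ n ih =>
      intro y
      refine (ih y).trans ?_
      rw [Finset.sum_range_succ, add_assoc]
      refine add_le_add le_rfl ?_
      have h3 := Tapp_iterate_mono (ν := ν) (K := shortKernel K b) h1 n y
      rw [Tapp_iterate_add hSm hhm] at h3
      rwa [Function.iterate_succ_apply]
  set E := {y | K x₀ y ≤ a} with hE
  set E' := {y | K x₀ y ≤ L * a} with hE'
  have hE'm : MeasurableSet E' := measurableSet_le (measurable_kernel_right hK x₀) measurable_const
  have h3 : ∀ i ≤ J, ∀ f : Ω → ℝ≥0∞, ∀ y ∈ E, S^[i] f y = S^[i] (E'.indicator f) y := by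
    intro i hi f y hy
    have hy' : K x₀ y ≤ a := hy
    refine Tapp_shortKernel_iterate_congr hL hQ i fun w hw => ?_
    have hw' : w ∈ E' := by
      rcases hw with rfl | hw
      · exact hy'.trans (le_mul_of_one_le_left zero_le hL)
      · by_contra hcon
        have hcon' : L * a < K x₀ w := not_le.mp hcon
        have h4 : min (K x₀ w) (K w y) ≤ L * a :=
          (hQ x₀ y w).trans (mul_le_mul_right hy' _)
        have h5 : K w y ≤ L * a := (min_le_iff.mp h4).resolve_left (not_le.mpr hcon')
        refine absurd hw (not_lt.mpr ?_)
        calc L ^ i * K y w ≤ L ^ J * (L * a) :=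
              mul_le_mul' (pow_le_pow_right' hL hi) (hs y w ▸ h5)
          _ = b := by rw [hbdef, pow_succ, mul_assoc]
    rw [Set.indicator_of_mem hw']
  have h4 : E.indicator g ≤ (fun y => ∑ i ∈ Finset.range J, S^[i] (E'.indicator h) y) +
      S^[J] (E'.indicator g) := by
    intro y
    by_cases hy : y ∈ E
    · rw [Set.indicator_of_mem hy]
      refine (h2 J y).trans_eq ?_
      simp only [Pi.add_apply]
      rw [h3 J le_rfl g y hy]
      congr 1
      exact Finset.sum_congr rfl fun i hi => h3 i (Finset.mem_range.mp hi).le h y hy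
    · rw [Set.indicator_of_notMem hy]; exact zero_le
  have h5 : E'.indicator h ≤ fun _ => (L + L ^ (J + 1)) * m * a := by
    intro y
    by_cases hy : y ∈ E'
    · rw [Set.indicator_of_mem hy]
      have hy' : K x₀ y ≤ L * a := hy
      calc K x₀ y + m * b ≤ m * (L * a) + m * b :=
            add_le_add (hy'.trans (le_mul_of_one_le_left zero_le h1m)) le_rfl
        _ = (L + L ^ (J + 1)) * m * a := by rw [hbdef]; ring
    · rw [Set.indicator_of_notMem hy]; exact zero_le
  have hbS : L2Bound ν (shortKernel K b) q := hb.shortKernel b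
  have hEh : Measurable (E'.indicator h) := hhm.indicator hE'm
  have hEg : Measurable (E'.indicator g) := hg.indicator hE'm
  calc l2norm ν (E.indicator g)
      ≤ l2norm ν (fun y => ∑ i ∈ Finset.range J, S^[i] (E'.indicator h) y) +
          l2norm ν (S^[J] (E'.indicator g)) :=
        (l2norm_mono h4).trans (l2norm_add_le
          (Finset.measurable_sum _ fun i _ => measurable_Tapp_iterate hSm hEh i)
          (measurable_Tapp_iterate hSm hEg J))
    _ ≤ (∑ i ∈ Finset.range J, (L + L ^ (J + 1)) * m * a * (ν Set.univ) ^ (1 / 2 : ℝ)) +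
          q ^ J * l2norm ν (E'.indicator g) := by
        refine add_le_add ((l2norm_sum_le (fun i => measurable_Tapp_iterate hSm hEh i) J).trans
          (Finset.sum_le_sum fun i _ => ?_)) (hbS.iterate hSm hEg J)
        refine (hbS.iterate hSm hEh i).trans ?_
        refine (mul_le_of_le_one_left zero_le (pow_le_one' hq i)).trans ?_
        exact (l2norm_mono h5).trans_eq (l2norm_const _)
    _ = _ := by
        rw [Finset.sum_const, Finset.card_range, nsmul_eq_mul]; ring

lemma l2norm_indicator_le [SFinite ν] [SFinite μ] (hμ : μ ≤ ν)
    (hK : Measurable fun p : Ω × Ω => K p.1 p.2) (hs : ∀ x y, K x y = K y x)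
    {L : ℝ≥0∞} (hL : 1 ≤ L) (hQ : ∀ x y z, min (K x z) (K z y) ≤ L * K x y)
    {q : ℝ≥0∞} (hq : q ≤ 1) (hb : L2Bound ν K q) (x₀ : Ω)
    {g : Ω → ℝ≥0∞} (hg : Measurable g) (hgle : ∀ y, g y ≤ K x₀ y + Tapp μ K g y)
    {m : ℝ≥0∞} (hm : 1 + ∫⁻ y, g y ∂μ ≤ m) {J : ℕ} (hJ : q ^ J * (L * 2) ≤ 1)
    (hfin : l2norm ν g ≠ ∞) (a : ℝ≥0∞) :
    l2norm ν ({y | K x₀ y ≤ a}.indicator g) ≤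
      2 * (J * (L + L ^ (J + 1))) * m * a * (ν Set.univ) ^ (1 / 2 : ℝ) := by
  set A : ℝ≥0∞ := J * (L + L ^ (J + 1))
  set V := (ν Set.univ) ^ (1 / 2 : ℝ)
  have hJ2 : q ^ J ≤ 2⁻¹ := by
    rw [ENNReal.le_inv_iff_mul_le]
    exact (mul_le_mul_right (le_mul_of_one_le_left zero_le hL) _).trans hJ
  have key : ∀ (n : ℕ) (a : ℝ≥0∞), l2norm ν ({y | K x₀ y ≤ a}.indicator g) ≤
      2 * A * m * a * V + 2⁻¹ ^ n * l2norm ν g := by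
    intro n
    induction n with
    | zero =>
      intro a
      rw [pow_zero, one_mul]
      exact (l2norm_mono (Set.indicator_le_self _ _)).trans le_add_self
    | succ n ih =>
      intro a
      calc l2norm ν ({y | K x₀ y ≤ a}.indicator g)
          ≤ A * m * a * V + q ^ J * l2norm ν ({y | K x₀ y ≤ L * a}.indicator g) :=
            l2norm_indicator_le_step hμ hK hs hL hQ hq hb x₀ hg hgle hm J a
        _ ≤ A * m * a * V + q ^ J * (2 * A * m * (L * a) * V + 2⁻¹ ^ n * l2norm ν g) :=
            add_le_add le_rfl (mul_le_mul_right (ih _) _)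
        _ = A * m * a * V + (q ^ J * (L * 2) * (A * m * a * V) +
              q ^ J * (2⁻¹ ^ n * l2norm ν g)) := by ring
        _ ≤ A * m * a * V + (1 * (A * m * a * V) + 2⁻¹ * (2⁻¹ ^ n * l2norm ν g)) :=
            add_le_add le_rfl (add_le_add (mul_le_mul_left hJ _) (mul_le_mul_left hJ2 _))
        _ = 2 * A * m * a * V + 2⁻¹ ^ (n + 1) * l2norm ν g := by ring
  have hlim : Filter.Tendsto (fun n : ℕ => 2 * A * m * a * V + 2⁻¹ ^ n * l2norm ν g)
      Filter.atTop (nhds (2 * A * m * a * V + 0 * l2norm ν g)) := by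
    refine tendsto_const_nhds.add (ENNReal.Tendsto.mul_const ?_ (Or.inr hfin))
    exact ENNReal.tendsto_pow_atTop_nhds_zero_of_lt_one (by norm_num)
  rw [zero_mul, add_zero] at hlim
  exact ge_of_tendsto' hlim fun n => key n a

/-- The Neumann series started at the kernel integrates to the Neumann series of `1`. -/
lemma neumann_one_eq [SFinite ν]
    (hK : Measurable fun p : Ω × Ω => K p.1 p.2) (hs : ∀ x y, K x y = K y x) (x₀ : Ω) :
    neumann ν K (fun _ => 1) x₀ = 1 + ∫⁻ y, neumann ν K (K x₀) y ∂ν := by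
  have hk := measurable_kernel_right hK x₀
  unfold neumann
  rw [tsum_eq_zero_add' ENNReal.summable,
    lintegral_tsum fun j => (measurable_Tapp_iterate hK hk j).aemeasurable]
  simp only [Function.iterate_zero, id_eq]
  congr 1
  refine tsum_congr fun j => ?_
  have := lintegral_Tapp_iterate_mul (ν := ν) hK hs hk (g := fun _ => 1) measurable_const j
  simp only [mul_one] at this
  rw [this, Function.iterate_succ_apply']
  rfl

/-- Enlarging the measure: the new paths are cut at their first visit to the added part. -/
lemma neumann_one_add_measure_le [SFinite ν] [SFinite μ]
    (hK : Measurable fun p : Ω × Ω => K p.1 p.2) (hs : ∀ x y, K x y = K y x) (x₀ : Ω) :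
    neumann (μ + ν) K (fun _ => 1) x₀ ≤ neumann μ K (fun _ => 1) x₀ +
      ∫⁻ z, neumann μ K (K x₀) z * neumann (μ + ν) K (fun _ => 1) z ∂ν := by
  have hk := measurable_kernel_right hK x₀
  have h1 : Measurable fun _ : Ω => (1 : ℝ≥0∞) := measurable_const
  set u := neumann (μ + ν) K (fun _ => 1) with hu
  have hum : Measurable u := measurable_neumann hK h1
  have hTu : Measurable (Tapp ν K u) := measurable_Tapp hK hum
  set w := neumann μ K ((fun _ => 1) + Tapp ν K u) with hw
  have hle : u ≤ w := by
    have key : ∀ n, (fun x => ∑ j ∈ Finset.range n, (Tapp (μ + ν) K)^[j] (fun _ => 1) x) ≤ w := by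
      intro n
      induction n with
      | zero => intro x; simp
      | succ n ih =>
        have hsm : (fun x => ∑ j ∈ Finset.range n, (Tapp (μ + ν) K)^[j] (fun _ => 1) x) ≤ u :=
          fun x => ENNReal.sum_le_tsum _
        intro x
        have h2 : ∑ j ∈ Finset.range (n + 1), (Tapp (μ + ν) K)^[j] (fun _ => 1) x =
            1 + Tapp (μ + ν) K
              (fun x => ∑ j ∈ Finset.range n, (Tapp (μ + ν) K)^[j] (fun _ => 1) x) x := by
          rw [Finset.sum_range_succ', add_comm]
          simp only [Function.iterate_succ_apply', Function.iterate_zero, id_eq]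
          congr 1
          simp only [Tapp, Finset.mul_sum]
          rw [lintegral_finsetSum]
          exact fun j _ => (measurable_kernel_right hK x).mul (measurable_Tapp_iterate hK h1 j)
        show ∑ j ∈ Finset.range (n + 1), (Tapp (μ + ν) K)^[j] (fun _ => 1) x ≤ w x
        rw [h2, hw, neumann_eq hK (h1.add hTu), Tapp_add_measure]
        simp only [Pi.add_apply]
        rw [add_assoc, add_comm (Tapp ν K u x)]
        exact add_le_add le_rfl (add_le_add (Tapp_mono ih x) (Tapp_mono hsm x))
    exact fun x => ENNReal.tsum_le_of_sum_range_le fun n => key n x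
  refine (hle x₀).trans ?_
  rw [hw, neumann_add hK h1, Pi.add_apply]
  refine add_le_add le_rfl (le_of_eq ?_)
  have h3 : ∀ z, neumann μ K (K x₀) z * u z = ∑' j, (Tapp μ K)^[j] (K x₀) z * u z :=
    fun z => ENNReal.tsum_mul_right.symm
  simp only [h3]
  rw [lintegral_tsum (f := fun j z => (Tapp μ K)^[j] (K x₀) z * u z)
    fun j => ((measurable_Tapp_iterate hK hk j).mul hum).aemeasurable]
  refine tsum_congr fun j => ?_
  cases j with
  | zero => rfl
  | succ j =>
    rw [Function.iterate_succ_apply', Function.iterate_succ_apply',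
      lintegral_Tapp_mul hK hs (measurable_Tapp_iterate hK hk j) hum,
      lintegral_Tapp_iterate_mul hK hs hk hTu]
    rfl

/-- One step of the multiscale argument. -/
lemma neumann_one_add_measure_le_mul [SFinite μ] [SFinite ν] [IsFiniteMeasure (μ + ν)]
    (hK : Measurable fun p : Ω × Ω => K p.1 p.2) (hs : ∀ x y, K x y = K y x)
    {L : ℝ≥0∞} (hL : 1 ≤ L) (hQ : ∀ x y z, min (K x z) (K z y) ≤ L * K x y)
    {q : ℝ≥0∞} (hq : q < 1) (hb : L2Bound (μ + ν) K q) (x₀ : Ω)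
    {J : ℕ} (hJ : q ^ J * (L * 2) ≤ 1) {a₀ : ℝ≥0∞} (ha₀ : a₀ ≠ ∞)
    (hν₀ : ∀ᵐ y ∂(μ + ν), K x₀ y ≤ a₀) {a : ℝ≥0∞} (hνa : ∀ᵐ y ∂ν, K x₀ y ≤ a) :
    neumann (μ + ν) K (fun _ => 1) x₀ ≤ neumann μ K (fun _ => 1) x₀ *
      (1 + 2 * (J * (L + L ^ (J + 1))) * (1 - q)⁻¹ * (a * (μ + ν) Set.univ)) := by
  have hk := measurable_kernel_right hK x₀
  have h1 : Measurable fun _ : Ω => (1 : ℝ≥0∞) := measurable_const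
  have hμ : μ ≤ μ + ν := Measure.le_add_right le_rfl
  have hν : ν ≤ μ + ν := Measure.le_add_left le_rfl
  set g := neumann μ K (K x₀) with hg
  set u := neumann (μ + ν) K (fun _ => 1) with hu
  set m := neumann μ K (fun _ => 1) x₀ with hm
  set V := ((μ + ν) Set.univ) ^ (1 / 2 : ℝ) with hV
  have hVV : V * V = (μ + ν) Set.univ := by
    rw [hV, ← ENNReal.rpow_add_of_nonneg _ _ (by norm_num) (by norm_num)]; norm_num
  have hgm : Measurable g := measurable_neumann hK hk
  have hum : Measurable u := measurable_neumann hK h1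
  have hVfin : V ≠ ∞ := ENNReal.rpow_ne_top_of_nonneg (by norm_num) (measure_ne_top _ _)
  have hinv : (1 - q)⁻¹ ≠ ∞ := by simpa [tsub_eq_zero_iff_le] using hq
  have hgfin : l2norm (μ + ν) g ≠ ∞ := by
    have h2 : l2norm (μ + ν) (K x₀) ≤ a₀ * V := by
      rw [← l2norm_const]
      refine ENNReal.rpow_le_rpow (lintegral_mono_ae ?_) (by norm_num)
      filter_upwards [hν₀] with y hy using pow_le_pow_left' hy 2
    refine ne_top_of_le_ne_top ?_ ((l2norm_mono (neumann_mono_measure hμ _)).trans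
      ((hb.neumann hK hk).trans (mul_le_mul_right h2 _)))
    exact ENNReal.mul_ne_top hinv (ENNReal.mul_ne_top ha₀ hVfin)
  have hdecay := l2norm_indicator_le hμ hK hs hL hQ hq.le hb x₀ hgm
    (fun y => (congrFun (neumann_eq hK hk) y).le) (neumann_one_eq hK hs x₀).ge hJ hgfin a
  have hEm : MeasurableSet {y | K x₀ y ≤ a} := measurableSet_le hk measurable_const
  have hint : ∫⁻ z, g z * u z ∂ν ≤ l2norm (μ + ν) ({y | K x₀ y ≤ a}.indicator g) *
      l2norm (μ + ν) u := by
    refine le_trans ?_ (lintegral_mul_le_l2norm (hgm.indicator hEm) hum)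
    refine le_trans (lintegral_mono_ae ?_) (lintegral_mono' hν le_rfl)
    filter_upwards [hνa] with z hz
    rw [Set.indicator_of_mem (show z ∈ {y | K x₀ y ≤ a} from hz)]
  have hu2 : l2norm (μ + ν) u ≤ (1 - q)⁻¹ * V := by
    have := hb.neumann hK h1
    rwa [l2norm_const, one_mul] at this
  calc u x₀ ≤ m + ∫⁻ z, g z * u z ∂ν := neumann_one_add_measure_le hK hs x₀
    _ ≤ m + (2 * (J * (L + L ^ (J + 1))) * m * a * V) * ((1 - q)⁻¹ * V) :=
        add_le_add le_rfl (hint.trans (mul_le_mul' hdecay hu2))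
    _ = m * (1 + 2 * (J * (L + L ^ (J + 1))) * (1 - q)⁻¹ * (a * (V * V))) := by ring
    _ = _ := by rw [hVV]

end Decay

section QuasiMetric

variable {Ω : Type*} [MeasurableSpace Ω] {ν : Measure Ω} {K : Ω → Ω → ℝ≥0∞}

lemma IsQuasiMetricKernel.min_le {κ : ℝ≥0} (h : IsQuasiMetricKernel K κ) (x y z : Ω) :
    min (K x z) (K z y) ≤ (max (2 * κ) 1 : ℝ≥0) * K x y := by
  set L : ℝ≥0 := max (2 * κ) 1
  have hL0 : (L : ℝ≥0∞) ≠ 0 := by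
    have : (0 : ℝ≥0) < L := lt_max_of_lt_right one_pos
    exact_mod_cast this.ne'
  set m := min (K x z) (K z y) with hm
  have h1 : (K x y)⁻¹ ≤ L * m⁻¹ := by
    calc (K x y)⁻¹ ≤ κ * ((K x z)⁻¹ + (K z y)⁻¹) := h.tri x y z
      _ ≤ κ * (m⁻¹ + m⁻¹) := by
          gcongr
          · exact min_le_left _ _
          · exact min_le_right _ _
      _ = (2 * κ : ℝ≥0) * m⁻¹ := by push_cast; ring
      _ ≤ L * m⁻¹ := by
          gcongr
          exact le_max_left _ _
  have h2 := ENNReal.inv_le_inv.mpr h1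
  rw [inv_inv, ENNReal.mul_inv (Or.inl hL0) (Or.inl ENNReal.coe_ne_top), inv_inv] at h2
  calc m = L * ((L : ℝ≥0∞)⁻¹ * m) := by
        rw [← mul_assoc, ENNReal.mul_inv_cancel hL0 ENNReal.coe_ne_top, one_mul]
    _ ≤ L * K x y := mul_le_mul_right h2 _

lemma lintegral_mul_le_of_le_kernel
    {L : ℝ≥0∞} (hQ : ∀ x y z, min (K x z) (K z y) ≤ L * K x y)
    {f g : Ω → Ω → ℝ≥0∞} {a b : ℝ≥0∞} (hf : ∀ x y, f x y ≤ a * K x y)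
    (hg : ∀ x y, g x y ≤ b * K x y) (x y : Ω) (hfm : Measurable (f x))
    (hgm : Measurable fun z => g z y) :
    ∫⁻ z, f x z * g z y ∂ν ≤
      L * K x y * (a * ∫⁻ z, g z y ∂ν + b * ∫⁻ z, f x z ∂ν) := by
  rw [← lintegral_const_mul _ hgm, ← lintegral_const_mul _ hfm,
    ← lintegral_add_left (hgm.const_mul a),
    ← lintegral_const_mul (f := fun z => a * g z y + b * f x z) _
      ((hgm.const_mul a).add (hfm.const_mul b))]
  refine lintegral_mono fun z => ?_
  rw [mul_add]
  rcases le_total (K x z) (K z y) with h | h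
  · have h1 := hQ x y z
    rw [min_eq_left h] at h1
    calc f x z * g z y ≤ (a * (L * K x y)) * g z y :=
          mul_le_mul_left ((hf x z).trans (mul_le_mul_right h1 _)) _
      _ = L * K x y * (a * g z y) := by ring
      _ ≤ _ := le_self_add
  · have h1 := hQ x y z
    rw [min_eq_right h] at h1
    calc f x z * g z y ≤ f x z * (b * (L * K x y)) :=
          mul_le_mul_right ((hg z y).trans (mul_le_mul_right h1 _)) _
      _ = L * K x y * (b * f x z) := by ring
      _ ≤ _ := le_add_self

/-- If `K₂ ≤ C K` then the potential of the constant function `1` is bounded. -/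
lemma lintegral_kernel_le (hK : Measurable fun p : Ω × Ω => K p.1 p.2)
    (hs : ∀ x y, K x y = K y x) (hpos : ∀ x y, K x y ≠ 0) {L : ℝ≥0∞} (hL : L ≠ ∞)
    (hQ : ∀ x y z, min (K x z) (K z y) ≤ L * K x y) (hfin : ∃ x y, K x y ≠ ∞)
    {C : ℝ≥0∞} (hC : ∀ x y, ∫⁻ z, K x z * K z y ∂ν ≤ C * K x y) (x : Ω) :
    ∫⁻ z, K x z ∂ν ≤ L * C := by
  have hk := measurable_kernel_right hK x
  obtain ⟨y₀, hy₀⟩ : ∃ y, K x y ≠ ∞ := by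
    by_contra! hcon
    obtain ⟨a, b, hab⟩ := hfin
    have := hQ a b x
    rw [hs a x, hcon a, hcon b, min_self, top_le_iff] at this
    exact ENNReal.mul_ne_top hL hab this
  have hset : ∀ y, K x y ≠ ∞ → ∫⁻ z in {z | K x y ≤ K x z}, K x z ∂ν ≤ L * C := by
    intro y hy
    have hm : MeasurableSet {z | K x y ≤ K x z} := measurableSet_le measurable_const hk
    have h1 : (∫⁻ z in {z | K x y ≤ K x z}, K x z ∂ν) * K x y ≤ L * C * K x y := by
      calc (∫⁻ z in {z | K x y ≤ K x z}, K x z ∂ν) * K x y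
          = ∫⁻ z in {z | K x y ≤ K x z}, K x z * K x y ∂ν := (lintegral_mul_const _ hk).symm
        _ ≤ ∫⁻ z in {z | K x y ≤ K x z}, L * (K x z * K z y) ∂ν := by
            refine setLIntegral_mono' hm fun z hz => ?_
            have h2 := hQ z y x
            rw [hs z x, min_eq_right (show K x y ≤ K x z from hz)] at h2
            calc K x z * K x y ≤ K x z * (L * K z y) := mul_le_mul_right h2 _
              _ = _ := by ring
        _ ≤ ∫⁻ z, L * (K x z * K z y) ∂ν := setLIntegral_le_lintegral _ _
        _ = L * ∫⁻ z, K x z * K z y ∂ν := lintegral_const_mul' _ _ hL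
        _ ≤ L * (C * K x y) := mul_le_mul_right (hC x y) _
        _ = L * C * K x y := by ring
    rwa [ENNReal.mul_le_mul_iff_left (hpos x y) hy] at h1
  obtain ⟨v, hv, hvS, hvz⟩ : ∃ v : ℕ → ℝ≥0∞, Antitone v ∧ (∀ n, ∃ y, K x y = v n ∧ v n ≠ ∞) ∧
      ∀ z, ∃ n, v n ≤ K x z := by
    set S := {c | ∃ y, K x y = c ∧ c ≠ ∞} with hS
    have hne : S.Nonempty := ⟨K x y₀, y₀, rfl, hy₀⟩
    have hmem : ∀ z, K x z ≠ ∞ → K x z ∈ S := fun z hz => ⟨z, rfl, hz⟩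
    by_cases hmin : sInf S ∈ S
    · refine ⟨fun _ => sInf S, antitone_const, fun _ => hmin, fun z => ⟨0, ?_⟩⟩
      by_cases hz : K x z = ∞
      · simp [hz]
      · exact sInf_le (hmem z hz)
    · obtain ⟨v, hv, hlim, hvS⟩ := exists_seq_tendsto_sInf hne (OrderBot.bddBelow S)
      refine ⟨v, hv, hvS, fun z => ?_⟩
      by_cases hz : K x z = ∞
      · exact ⟨0, by simp [hz]⟩
      · have hlt : sInf S < K x z := lt_of_le_of_ne (sInf_le (hmem z hz)) fun h =>
          hmin (h ▸ hmem z hz)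
        obtain ⟨n, hn⟩ := (hlim.eventually_lt_const hlt).exists
        exact ⟨n, hn.le⟩
  have hun : ⋃ n, {z | v n ≤ K x z} = Set.univ := by
    ext z; simpa using hvz z
  rw [← setLIntegral_univ, ← hun, setLIntegral_iUnion_of_directed]
  · refine iSup_le fun n => ?_
    obtain ⟨y, hy, hyn⟩ := hvS n
    have := hset y (hy ▸ hyn)
    rwa [hy] at this
  · exact (monotone_nat_of_le_succ fun n z (hz : v n ≤ K x z) =>
      (hv n.le_succ).trans hz).directed_le

end QuasiMetric

section Iterates

variable {Ω : Type*} [MeasurableSpace Ω] {ν : Measure Ω} {K : Ω → Ω → ℝ≥0∞}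

lemma measurable_Kiter [SFinite ν] (hK : Measurable fun p : Ω × Ω => K p.1 p.2) (n : ℕ) :
    Measurable fun p : Ω × Ω => Kiter ν K n p.1 p.2 := by
  induction n with
  | zero => exact hK
  | succ n ih =>
    refine Measurable.lintegral_prod_right'
      (f := fun p : (Ω × Ω) × Ω => Kiter ν K n p.1.1 p.2 * K p.2 p.1.2) ?_
    exact (ih.comp (measurable_fst.fst.prodMk measurable_snd)).mul
      (hK.comp (measurable_snd.prodMk measurable_fst.snd))

lemma measurable_Kiter_left [SFinite ν] (hK : Measurable fun p : Ω × Ω => K p.1 p.2) (n : ℕ)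
    (y : Ω) : Measurable fun x => Kiter ν K n x y :=
  (measurable_Kiter hK n).comp (measurable_id.prodMk measurable_const)

lemma lintegral_Kiter_mul [SFinite ν] (hK : Measurable fun p : Ω × Ω => K p.1 p.2) (n : ℕ)
    {f : Ω → ℝ≥0∞} (hf : Measurable f) (x : Ω) :
    ∫⁻ y, Kiter ν K n x y * f y ∂ν = (Tapp ν K)^[n + 1] f x := by
  induction n generalizing f with
  | zero => rfl
  | succ n ih =>
    rw [Function.iterate_succ_apply, ← ih (measurable_Tapp hK hf)]
    have hm := measurable_kernel_right (measurable_Kiter (ν := ν) hK n) x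
    calc ∫⁻ y, (∫⁻ z, Kiter ν K n x z * K z y ∂ν) * f y ∂ν
        = ∫⁻ y, ∫⁻ z, Kiter ν K n x z * K z y * f y ∂ν ∂ν :=
          lintegral_congr fun y => (lintegral_mul_const _
            (hm.mul (hK.comp (measurable_id.prodMk measurable_const)))).symm
      _ = ∫⁻ z, ∫⁻ y, Kiter ν K n x z * K z y * f y ∂ν ∂ν := by
          refine lintegral_lintegral_swap (Measurable.aemeasurable ?_)
          exact ((hm.comp measurable_snd).mul (hK.comp measurable_swap)).mul
            (hf.comp measurable_fst)
      _ = ∫⁻ z, Kiter ν K n x z * Tapp ν K f z ∂ν := by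
          refine lintegral_congr fun z => ?_
          simp only [Tapp, mul_assoc]
          exact lintegral_const_mul _ ((measurable_kernel_right hK z).mul hf)

lemma Kiter_add [SFinite ν] (hK : Measurable fun p : Ω × Ω => K p.1 p.2) (m n : ℕ) (x y : Ω) :
    Kiter ν K (m + n + 1) x y = ∫⁻ z, Kiter ν K m x z * Kiter ν K n z y ∂ν := by
  induction n generalizing y with
  | zero => rfl
  | succ n ih =>
    have hm := measurable_kernel_right (measurable_Kiter (ν := ν) hK m) x
    have hn := measurable_Kiter (ν := ν) hK n
    have hy : Measurable fun w => K w y := hK.comp (measurable_id.prodMk measurable_const)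
    calc ∫⁻ w, Kiter ν K (m + n + 1) x w * K w y ∂ν
        = ∫⁻ w, ∫⁻ z, Kiter ν K m x z * Kiter ν K n z w * K w y ∂ν ∂ν := by
          refine lintegral_congr fun w => ?_
          rw [ih]
          exact (lintegral_mul_const _ (hm.mul (measurable_Kiter_left hK n w))).symm
      _ = ∫⁻ z, ∫⁻ w, Kiter ν K m x z * Kiter ν K n z w * K w y ∂ν ∂ν := by
          refine lintegral_lintegral_swap (Measurable.aemeasurable ?_)
          exact ((hm.comp measurable_snd).mul (hn.comp measurable_swap)).mul
            (hy.comp measurable_fst)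
      _ = ∫⁻ z, Kiter ν K m x z * Kiter ν K (n + 1) z y ∂ν := by
          refine lintegral_congr fun z => ?_
          simp only [mul_assoc]
          exact lintegral_const_mul _ ((measurable_kernel_right hn z).mul hy)

lemma Kiter_symm [SFinite ν] (hK : Measurable fun p : Ω × Ω => K p.1 p.2)
    (hs : ∀ x y, K x y = K y x) (n : ℕ) (x y : Ω) : Kiter ν K n x y = Kiter ν K n y x := by
  induction n generalizing x y with
  | zero => exact hs x y
  | succ n ih =>
    have h := Kiter_add (ν := ν) hK 0 n y x
    rw [zero_add] at h
    rw [h]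
    refine lintegral_congr fun z => ?_
    rw [ih x z, hs z y, mul_comm]
    rfl

lemma lintegral_Kiter [SFinite ν] (hK : Measurable fun p : Ω × Ω => K p.1 p.2) (n : ℕ) (x : Ω) :
    ∫⁻ y, Kiter ν K n x y ∂ν = (Tapp ν K)^[n + 1] (fun _ => 1) x := by
  simpa using lintegral_Kiter_mul (ν := ν) hK n (f := fun _ => 1) measurable_const x

/-- If all iterates of `1` are bounded by `M` and tend to zero uniformly, then the sum
of the iterated kernels is bounded by a multiple of the kernel. -/
lemma exists_tsum_Kiter_le [SFinite ν] (hK : Measurable fun p : Ω × Ω => K p.1 p.2)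
    (hs : ∀ x y, K x y = K y x) {L : ℝ≥0∞} (hL : L ≠ ∞)
    (hQ : ∀ x y z, min (K x z) (K z y) ≤ L * K x y) {M : ℝ≥0∞} (hM : M ≠ ∞)
    (hu : ∀ x, neumann ν K (fun _ => 1) x ≤ M) {N : ℕ} {t : ℝ≥0∞}
    (ht : ∀ x, (Tapp ν K)^[N + 1] (fun _ => 1) x ≤ t) (hLt : L * t * 2 ≤ 1) :
    ∃ C : ℝ≥0∞, C ≠ ∞ ∧ ∀ x y, ∑' j, Kiter ν K j x y ≤ C * K x y := by
  have hkm : ∀ n x, Measurable (Kiter ν K n x) := fun n x =>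
    measurable_kernel_right (measurable_Kiter hK n) x
  have hcol : ∀ n y, ∫⁻ z, Kiter ν K n z y ∂ν = (Tapp ν K)^[n + 1] (fun _ => 1) y := by
    intro n y
    rw [← lintegral_Kiter hK]
    exact lintegral_congr fun z => Kiter_symm hK hs n z y
  have hTM : ∀ n y, (Tapp ν K)^[n] (fun _ => 1) y ≤ M := fun n y =>
    (ENNReal.le_tsum n).trans (hu y)
  have hA : ∀ n, ∃ A : ℝ≥0∞, A ≠ ∞ ∧ ∀ x y, Kiter ν K n x y ≤ A * K x y := by
    intro n
    induction n with
    | zero => exact ⟨1, by simp, fun x y => by rw [one_mul]; rfl⟩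
    | succ n ih =>
      obtain ⟨A, hA, hAK⟩ := ih
      refine ⟨L * (A * M + 1 * M), by finiteness, fun x y => ?_⟩
      refine (lintegral_mul_le_of_le_kernel hQ hAK (g := K) (b := 1)
        (fun x y => by rw [one_mul]) x y (hkm n x)
        (measurable_Kiter_left (ν := ν) hK 0 y)).trans ?_
      rw [mul_right_comm]
      refine mul_le_mul_left (mul_le_mul_right (add_le_add (mul_le_mul_right ?_ _)
        (mul_le_mul_right ?_ _)) _) _
      · exact (hcol 0 y).trans_le (hTM _ y)
      · exact (lintegral_Kiter hK n x).trans_le (hTM _ x)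
  choose A hAfin hAK using hA
  set D := ∑ n ∈ Finset.range (N + 1), A n + L * (A N * M) with hD
  have hDfin : D ≠ ∞ := ENNReal.add_ne_top.mpr
    ⟨ENNReal.sum_ne_top.mpr fun n _ => hAfin n,
      ENNReal.mul_ne_top hL (ENNReal.mul_ne_top (hAfin N) hM)⟩
  have key : ∀ i : ℕ, ∀ x y,
      ∑ n ∈ Finset.range (i * (N + 1)), Kiter ν K n x y ≤ 2 * D * K x y := by
    intro i
    induction i with
    | zero => intro x y; simp
    | succ i ih =>
      intro x y
      set P := i * (N + 1)
      have hsplit : ∑ n ∈ Finset.range ((i + 1) * (N + 1)), Kiter ν K n x y =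
          ∑ n ∈ Finset.range (N + 1), Kiter ν K n x y +
            ∫⁻ z, (∑ n ∈ Finset.range P, Kiter ν K n x z) * Kiter ν K N z y ∂ν := by
        rw [show (i + 1) * (N + 1) = (N + 1) + P by simp only [P]; ring, Finset.sum_range_add]
        congr 1
        simp only [Finset.sum_mul]
        rw [lintegral_finsetSum]
        · refine Finset.sum_congr rfl fun n _ => ?_
          rw [← Kiter_add hK]
          congr 1
          ring
        · exact fun n _ => (hkm n x).mul (measurable_Kiter_left hK N y)
      rw [hsplit]
      have h1 : ∑ n ∈ Finset.range (N + 1), Kiter ν K n x y ≤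
          (∑ n ∈ Finset.range (N + 1), A n) * K x y := by
        rw [Finset.sum_mul]
        exact Finset.sum_le_sum fun n _ => hAK n x y
      have h2 := lintegral_mul_le_of_le_kernel (ν := ν) hQ
        (f := fun x y => ∑ n ∈ Finset.range P, Kiter ν K n x y) ih (hAK N) x y
        (Finset.measurable_sum _ fun n _ => hkm n x) (measurable_Kiter_left hK N y)
      have h3 : ∫⁻ z, ∑ n ∈ Finset.range P, Kiter ν K n x z ∂ν ≤ M := by
        rw [lintegral_finsetSum _ fun n _ => hkm n x]
        simp only [lintegral_Kiter hK]
        refine le_trans ?_ (hu x)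
        rw [neumann, tsum_eq_zero_add' ENNReal.summable]
        exact (ENNReal.sum_le_tsum _).trans le_add_self
      have h4 : ∫⁻ z, Kiter ν K N z y ∂ν ≤ t := (hcol N y).trans_le (ht y)
      calc _ ≤ (∑ n ∈ Finset.range (N + 1), A n) * K x y +
            L * K x y * (2 * D * t + A N * M) :=
            add_le_add h1 (h2.trans (mul_le_mul_right (add_le_add (mul_le_mul_right h4 _)
              (mul_le_mul_right h3 _)) _))
        _ = D * K x y + (L * t * 2) * (D * K x y) := by rw [hD]; ring
        _ ≤ D * K x y + 1 * (D * K x y) := add_le_add le_rfl (mul_le_mul_left hLt _)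
        _ = 2 * D * K x y := by ring
  refine ⟨2 * D, by finiteness, fun x y => ENNReal.tsum_le_of_sum_range_le fun P => ?_⟩
  refine le_trans (Finset.sum_le_sum_of_subset (Finset.range_mono ?_)) (key P x y)
  exact Nat.le_mul_of_pos_right P N.succ_pos

end Iterates

section Schur

variable {Ω : Type*} [MeasurableSpace Ω] {ν : Measure Ω} {K : Ω → Ω → ℝ≥0∞}

/-- Schur's test. -/
lemma opNorm_le_of_Tapp_le [SFinite ν] (hK : Measurable fun p : Ω × Ω => K p.1 p.2)
    (hs : ∀ x y, K x y = K y x) {u : Ω → ℝ≥0∞} (hu : Measurable u) (hu0 : ∀ x, u x ≠ 0)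
    (hut : ∀ x, u x ≠ ∞) {r : ℝ≥0∞} (h : ∀ x, Tapp ν K u x ≤ r * u x) : opNorm ν K ≤ r := by
  refine iSup_le fun f => iSup_le fun hf => iSup_le fun hf1 => ?_
  set v : Ω → ℝ≥0∞ := fun x => u x ^ (1 / 2 : ℝ) with hv
  have hvm : Measurable v := hu.pow_const _
  have hv2 : ∀ x, v x ^ 2 = u x := fun x => by
    rw [hv, ← ENNReal.rpow_natCast, ← ENNReal.rpow_mul]; norm_num
  have hv0 : ∀ x, v x ≠ 0 := fun x hx => hu0 x (by rw [← hv2, hx]; simp)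
  have hvt : ∀ x, v x ≠ ∞ := fun x hx => hut x (by rw [← hv2, hx]; simp)
  set w : Ω → ℝ≥0∞ := fun y => f y ^ 2 * (u y)⁻¹ with hw
  have hwm : Measurable w := (hf.pow_const 2).mul hu.inv
  have hl2 : ∀ (ρ : Measure Ω) (g : Ω → ℝ≥0∞), l2norm ρ g ^ 2 = ∫⁻ x, g x ^ 2 ∂ρ := by
    intro ρ g
    rw [l2norm, ← ENNReal.rpow_natCast, ← ENNReal.rpow_mul]; norm_num
  have hpt : ∀ x, (∫⁻ y, K x y * f y ∂ν) ^ 2 ≤ r * (Tapp ν K w x * u x) := by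
    intro x
    have hk := measurable_kernel_right hK x
    have h1 := lintegral_mul_le_l2norm (ν := ν.withDensity (K x)) hvm
      (g := fun y => f y * (v y)⁻¹) (hf.mul hvm.inv)
    have h2 := pow_le_pow_left' h1 2
    rw [mul_pow, hl2, hl2] at h2
    have e1 : ∀ y, v y * (f y * (v y)⁻¹) = f y := fun y => by
      rw [mul_left_comm, ENNReal.mul_inv_cancel (hv0 y) (hvt y), mul_one]
    have e2 : ∀ y, (f y * (v y)⁻¹) ^ 2 = w y := fun y => by
      rw [mul_pow, ← ENNReal.inv_pow, hv2]
    simp only [e1, e2, hv2] at h2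
    rw [lintegral_withDensity_eq_lintegral_mul _ hk hf,
      lintegral_withDensity_eq_lintegral_mul _ hk hu,
      lintegral_withDensity_eq_lintegral_mul _ hk hwm] at h2
    calc (∫⁻ y, K x y * f y ∂ν) ^ 2 ≤ Tapp ν K u x * Tapp ν K w x := h2
      _ ≤ r * u x * Tapp ν K w x := mul_le_mul_left (h x) _
      _ = _ := by ring
  have hint : ∫⁻ x, (∫⁻ y, K x y * f y ∂ν) ^ 2 ∂ν ≤ r ^ 2 := by
    calc _ ≤ ∫⁻ x, r * (Tapp ν K w x * u x) ∂ν := lintegral_mono hpt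
      _ = r * ∫⁻ y, w y * Tapp ν K u y ∂ν := by
          rw [lintegral_const_mul (f := fun x => Tapp ν K w x * u x) _
            ((measurable_Tapp hK hwm).mul hu),
            lintegral_Tapp_mul hK hs hwm hu]
      _ ≤ r * ∫⁻ y, r * f y ^ 2 ∂ν := by
          refine mul_le_mul_right (lintegral_mono fun y => ?_) _
          calc w y * Tapp ν K u y ≤ f y ^ 2 * (u y)⁻¹ * (r * u y) := mul_le_mul_right (h y) _
            _ = r * f y ^ 2 * (u y * (u y)⁻¹) := by ring
            _ = r * f y ^ 2 := by rw [ENNReal.mul_inv_cancel (hu0 y) (hut y), mul_one]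
      _ = r ^ 2 * ∫⁻ y, f y ^ 2 ∂ν := by rw [lintegral_const_mul _ (hf.pow_const 2)]; ring
      _ ≤ r ^ 2 * 1 := mul_le_mul_right hf1 _
      _ = r ^ 2 := mul_one _
  rw [one_div, ENNReal.rpow_inv_le_iff (by norm_num)]
  simpa using hint

lemma Tapp_neumann_one_le [SFinite ν] (hK : Measurable fun p : Ω × Ω => K p.1 p.2)
    {M : ℝ≥0∞} (hM : M ≠ ∞) (hM1 : 1 ≤ M) (hu : ∀ x, neumann ν K (fun _ => 1) x ≤ M) (x : Ω) :
    Tapp ν K (neumann ν K fun _ => 1) x ≤ (1 - M⁻¹) * neumann ν K (fun _ => 1) x := by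
  set u := neumann ν K fun _ => 1 with hudef
  have hM0 : M ≠ 0 := (zero_lt_one.trans_le hM1).ne'
  have hinv : M⁻¹ ≤ 1 := ENNReal.inv_le_one.mpr hM1
  have hfin : M⁻¹ * u x ≠ ∞ := ENNReal.mul_ne_top (ENNReal.inv_ne_top.mpr hM0)
    (ne_top_of_le_ne_top hM (hu x))
  have h1 : M⁻¹ * u x ≤ 1 :=
    (mul_le_mul_right (hu x) _).trans_eq (ENNReal.inv_mul_cancel hM0 hM)
  have h2 : u x = 1 + Tapp ν K u x := congrFun (neumann_eq hK measurable_const) x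
  refine (ENNReal.add_le_add_iff_right hfin).mp ?_
  rw [← add_mul, tsub_add_cancel_of_le hinv, one_mul]
  calc Tapp ν K u x + M⁻¹ * u x ≤ Tapp ν K u x + 1 := add_le_add le_rfl h1
    _ = u x := by rw [add_comm, ← h2]

lemma Tapp_iterate_one_le [SFinite ν] (hK : Measurable fun p : Ω × Ω => K p.1 p.2)
    {M : ℝ≥0∞} (hM : M ≠ ∞) (hM1 : 1 ≤ M) (hu : ∀ x, neumann ν K (fun _ => 1) x ≤ M)
    (n : ℕ) (x : Ω) : (Tapp ν K)^[n] (fun _ => 1) x ≤ (1 - M⁻¹) ^ n * M := by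
  have hum : Measurable (neumann ν K fun _ => 1) := measurable_neumann hK measurable_const
  have key : ∀ n, (Tapp ν K)^[n] (fun _ => 1) ≤
      fun x => (1 - M⁻¹) ^ n * neumann ν K (fun _ => 1) x := by
    intro n
    induction n with
    | zero =>
      intro x
      simpa [neumann] using ENNReal.le_tsum (f := fun j => (Tapp ν K)^[j] (fun _ => 1) x) 0
    | succ n ih =>
      intro x
      rw [Function.iterate_succ_apply']
      refine (Tapp_mono ih x).trans ?_
      rw [Tapp_const_mul hK hum]
      dsimp only
      rw [pow_succ, mul_assoc]
      exact mul_le_mul_right (Tapp_neumann_one_le hK hM hM1 hu x) _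
  exact (key n x).trans (mul_le_mul_right (hu x) _)

end Schur

section Multiscale

variable {Ω : Type*} [MeasurableSpace Ω] {ν : Measure Ω} {K : Ω → Ω → ℝ≥0∞}

lemma sum_dyadic_le (a c : ℝ≥0∞) (k : ℕ) :
    ∑ i ∈ Finset.range k, (if a * 2⁻¹ ^ (i + 1) < c then a * 2⁻¹ ^ i else 0) ≤ 4 * c := by
  have hhalf : ∀ i : ℕ, a * 2⁻¹ ^ i = 2 * (a * 2⁻¹ ^ (i + 1)) := fun i => by
    calc a * 2⁻¹ ^ i = (2 * 2⁻¹) * (a * 2⁻¹ ^ i) := by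
          rw [ENNReal.mul_inv_cancel (by norm_num) (by norm_num), one_mul]
      _ = _ := by ring
  set S : ℕ → ℝ≥0∞ := fun k =>
    ∑ i ∈ Finset.range k, (if a * 2⁻¹ ^ (i + 1) < c then a * 2⁻¹ ^ i else 0) with hS
  have key : ∀ k, S k = 0 ∨ S k + 2 * (a * 2⁻¹ ^ k) ≤ 4 * c := by
    intro k
    induction k with
    | zero => left; simp [hS]
    | succ k ih =>
      have hstep : S (k + 1) = S k + if a * 2⁻¹ ^ (k + 1) < c then a * 2⁻¹ ^ k else 0 :=
        Finset.sum_range_succ _ _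
      rcases ih with ih | ih
      · split_ifs at hstep with h
        · right
          rw [hstep, ih, zero_add, hhalf]
          calc _ = 4 * (a * 2⁻¹ ^ (k + 1)) := by ring
            _ ≤ 4 * c := mul_le_mul_right h.le _
        · left; rw [hstep, ih, zero_add]
      · right
        refine le_trans ?_ ih
        rw [hstep, add_assoc, ← hhalf, two_mul]
        refine add_le_add le_rfl (add_le_add ?_ le_rfl)
        split_ifs <;> simp
  rcases key k with h | h
  · exact h.trans_le zero_le
  · exact le_self_add.trans h

lemma neumann_one_restrict_le [SFinite ν] (hK : Measurable fun p : Ω × Ω => K p.1 p.2)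
    (hs : ∀ x y, K x y = K y x) {L : ℝ≥0∞} (hL : 1 ≤ L) (hLt : L ≠ ∞)
    (hQ : ∀ x y z, min (K x z) (K z y) ≤ L * K x y) {q : ℝ≥0∞} (hq : q < 1)
    (hb : L2Bound ν K q) {J : ℕ} (hJ : q ^ J * (L * 2) ≤ 1) {M : ℝ≥0∞} (hM : M ≠ ∞)
    (x₀ : Ω) (hx₀ : ∫⁻ z, K x₀ z ∂ν ≤ M) {a : ℝ≥0∞} (ha0 : a ≠ 0) (ha : a ≠ ∞) (k : ℕ) :
    neumann (ν.restrict {z | a * 2⁻¹ ^ k < K x₀ z ∧ K x₀ z ≤ a}) K (fun _ => 1) x₀ ≤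
      ENNReal.ofReal (Real.exp
        (2 * (J * (L + L ^ (J + 1))) * (1 - q)⁻¹ * (4 * M)).toReal) := by
  have hk := measurable_kernel_right hK x₀
  set C := 2 * (J * (L + L ^ (J + 1))) * (1 - q)⁻¹ with hC
  have hinv : (1 - q)⁻¹ ≠ ∞ := by simpa [tsub_eq_zero_iff_le] using hq
  have hCfin : C ≠ ∞ := by
    refine ENNReal.mul_ne_top (ENNReal.mul_ne_top (by norm_num)
      (ENNReal.mul_ne_top (ENNReal.natCast_ne_top J) ?_)) hinv
    exact ENNReal.add_ne_top.mpr ⟨hLt, ENNReal.pow_ne_top hLt⟩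
  set α : ℕ → ℝ≥0∞ := fun k => a * 2⁻¹ ^ k with hα
  have hα0 : ∀ k, α k ≠ 0 := fun k => mul_ne_zero ha0 (pow_ne_zero _ (by norm_num))
  have hαanti : Antitone α := fun i j h =>
    mul_le_mul_right (pow_le_pow_right_of_le_one' (by norm_num) h) _
  set B : ℕ → Set Ω := fun k => {z | α k < K x₀ z ∧ K x₀ z ≤ a} with hB
  have hBm : ∀ k, MeasurableSet (B k) := fun k =>
    (measurableSet_lt measurable_const hk).inter (measurableSet_le hk measurable_const)
  have hBfin : ∀ k, ν (B k) ≠ ∞ := by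
    intro k hcon
    have h1 : α k * ν (B k) ≤ M := by
      refine le_trans (mul_le_mul_right (measure_mono fun z hz => ?_) _)
        ((mul_meas_ge_le_lintegral hk (α k)).trans hx₀)
      exact hz.1.le
    rw [hcon, ENNReal.mul_top (hα0 k), top_le_iff] at h1
    exact hM h1
  set m : ℕ → ℝ≥0∞ := fun k => neumann (ν.restrict (B k)) K (fun _ => 1) x₀ with hm
  have hm0 : m 0 ≤ 1 := by
    have : B 0 = ∅ := by
      ext z; simp [hB, hα]
    simp only [hm, this, Measure.restrict_empty]
    rw [neumann_eq hK measurable_const]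
    simp [Tapp]
  set X : ℕ → ℝ≥0∞ := fun k => C * (α k * ν (B (k + 1))) with hX
  have hXfin : ∀ k, X k ≠ ∞ := fun k => ENNReal.mul_ne_top hCfin (ENNReal.mul_ne_top
    (ENNReal.mul_ne_top ha (ENNReal.pow_ne_top (by norm_num))) (hBfin _))
  have hstep : ∀ k, m (k + 1) ≤ m k * (1 + X k) := by
    intro k
    set D : Set Ω := {z | α (k + 1) < K x₀ z ∧ K x₀ z ≤ α k} with hD
    have hDm : MeasurableSet D :=
      (measurableSet_lt measurable_const hk).inter (measurableSet_le hk measurable_const)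
    have hdisj : Disjoint (B k) D := Set.disjoint_left.mpr fun z hz hz' =>
      absurd hz.1 (not_lt.mpr hz'.2)
    have hle : α k ≤ a := by simpa [hα] using hαanti (Nat.zero_le k)
    have hun : B (k + 1) = B k ∪ D := by
      ext z
      simp only [hB, hD, Set.mem_ofPred_eq, Set.mem_union]
      constructor
      · rintro ⟨h1, h2⟩
        rcases lt_or_ge (α k) (K x₀ z) with h | h
        · exact Or.inl ⟨h, h2⟩
        · exact Or.inr ⟨h1, h⟩
      · rintro (⟨h1, h2⟩ | ⟨h1, h2⟩)
        · exact ⟨(hαanti k.le_succ).trans_lt h1, h2⟩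
        · exact ⟨h1, h2.trans hle⟩
    have hsplit : ν.restrict (B k) + ν.restrict D = ν.restrict (B (k + 1)) := by
      rw [hun, Measure.restrict_union hdisj hDm]
    have : IsFiniteMeasure (ν.restrict (B k) + ν.restrict D) := by
      rw [hsplit]
      exact ⟨by rw [Measure.restrict_apply_univ]; exact (hBfin _).lt_top⟩
    have := neumann_one_add_measure_le_mul (μ := ν.restrict (B k)) (ν := ν.restrict D) hK hs hL
      hQ hq (by rw [hsplit]; exact hb.restrict (hBm _)) x₀ hJ ha
      (by
        rw [hsplit]
        filter_upwards [ae_restrict_mem (hBm (k + 1))] with z hz using hz.2)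
      (a := α k) (by filter_upwards [ae_restrict_mem hDm] with z hz using hz.2)
    rw [hsplit, Measure.restrict_apply_univ] at this
    exact this
  have hexp : ∀ k, m k ≤ ENNReal.ofReal (Real.exp (∑ i ∈ Finset.range k, X i).toReal) := by
    intro k
    induction k with
    | zero => simpa using hm0
    | succ k ih =>
      have h1 : 1 + X k ≤ ENNReal.ofReal (Real.exp (X k).toReal) := by
        rw [← ENNReal.ofReal_toReal (hXfin k), ← ENNReal.ofReal_one,
          ← ENNReal.ofReal_add zero_le_one ENNReal.toReal_nonneg,
          ENNReal.toReal_ofReal ENNReal.toReal_nonneg, add_comm]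
        exact ENNReal.ofReal_le_ofReal (Real.add_one_le_exp _)
      rw [Finset.sum_range_succ,
        ENNReal.toReal_add (ENNReal.sum_ne_top.mpr fun i _ => hXfin i) (hXfin k),
        Real.exp_add, ENNReal.ofReal_mul (Real.exp_pos _).le]
      exact (hstep k).trans (mul_le_mul' ih h1)
  have hsum : ∑ i ∈ Finset.range k, X i ≤ C * (4 * M) := by
    rw [← Finset.mul_sum]
    refine mul_le_mul_right ?_ _
    have h1 : ∀ i, α i * ν (B (i + 1)) ≤ ∫⁻ z, (if α (i + 1) < K x₀ z then α i else 0) ∂ν := by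
      intro i
      rw [← lintegral_indicator_const (hBm (i + 1))]
      refine lintegral_mono fun z => ?_
      by_cases hz : z ∈ B (i + 1)
      · rw [Set.indicator_of_mem hz, if_pos hz.1]
      · rw [Set.indicator_of_notMem hz]; exact zero_le
    calc _ ≤ ∑ i ∈ Finset.range k, ∫⁻ z, (if α (i + 1) < K x₀ z then α i else 0) ∂ν :=
          Finset.sum_le_sum fun i _ => h1 i
      _ = ∫⁻ z, ∑ i ∈ Finset.range k, (if α (i + 1) < K x₀ z then α i else 0) ∂ν := by
          rw [lintegral_finsetSum]
          exact fun i _ => Measurable.ite (measurableSet_lt measurable_const hk)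
            measurable_const measurable_const
      _ ≤ ∫⁻ z, 4 * K x₀ z ∂ν := lintegral_mono fun z => sum_dyadic_le a _ k
      _ = 4 * ∫⁻ z, K x₀ z ∂ν := lintegral_const_mul _ hk
      _ ≤ 4 * M := mul_le_mul_right hx₀ _
  refine (hexp k).trans (ENNReal.ofReal_le_ofReal (Real.exp_le_exp.mpr
    (ENNReal.toReal_mono ?_ hsum)))
  exact ENNReal.mul_ne_top hCfin (ENNReal.mul_ne_top (by norm_num) hM)

/-- Monotone convergence of the Neumann series along an exhaustion. -/
lemma neumann_le_of_restrict_le [SFinite ν] (hK : Measurable fun p : Ω × Ω => K p.1 p.2)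
    {f : Ω → ℝ≥0∞} (hf : Measurable f) {E : ℕ → Set Ω} (hE : Monotone E)
    (hEm : ∀ n, MeasurableSet (E n)) (hae : ∀ᵐ y ∂ν, ∃ n, y ∈ E n) {C : ℝ≥0∞} {x : Ω}
    (h : ∀ n, neumann (ν.restrict (E n)) K f x ≤ C) : neumann ν K f x ≤ C := by
  have hmono : ∀ j y, Monotone fun n => (Tapp (ν.restrict (E n)) K)^[j] f y :=
    fun j y n n' hn => Tapp_iterate_mono_measure (Measure.restrict_mono_set ν (hE hn)) f j y
  have key : ∀ j x, (Tapp ν K)^[j] f x ≤ ⨆ n, (Tapp (ν.restrict (E n)) K)^[j] f x := by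
    intro j
    induction j with
    | zero => intro x; simp
    | succ j ih =>
      intro x
      simp only [Function.iterate_succ_apply']
      have hk := measurable_kernel_right hK x
      set g : ℕ → Ω → ℝ≥0∞ := fun n => (E n).indicator ((Tapp (ν.restrict (E n)) K)^[j] f)
        with hg
      have hgm : ∀ n, Measurable (g n) := fun n =>
        (measurable_Tapp_iterate hK hf j).indicator (hEm n)
      have hgmono : Monotone g := by
        intro n n' hn y
        by_cases hy : y ∈ E n
        · simp only [hg, Set.indicator_of_mem hy, Set.indicator_of_mem (hE hn hy)]
          exact hmono j y hn
        · simp only [hg, Set.indicator_of_notMem hy]; exact zero_le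
      calc Tapp ν K ((Tapp ν K)^[j] f) x ≤ ∫⁻ y, ⨆ n, K x y * g n y ∂ν := by
            refine lintegral_mono_ae ?_
            filter_upwards [hae] with y hy
            obtain ⟨N, hN⟩ := hy
            rw [← ENNReal.mul_iSup]
            refine mul_le_mul_right ((ih y).trans (iSup_le fun n => ?_)) _
            refine le_iSup_of_le (max n N) ?_
            rw [hg]
            dsimp only
            rw [Set.indicator_of_mem (hE (le_max_right n N) hN)]
            exact hmono j y (le_max_left n N)
        _ = ⨆ n, ∫⁻ y, K x y * g n y ∂ν :=
            lintegral_iSup (fun n => hk.mul (hgm n))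
              fun n n' hn y => mul_le_mul_right (hgmono hn y) _
        _ = ⨆ n, Tapp (ν.restrict (E n)) K ((Tapp (ν.restrict (E n)) K)^[j] f) x := by
            simp only [Tapp_restrict (hEm _)]
            rfl
  refine ENNReal.tsum_le_of_sum_range_le fun P => ?_
  calc ∑ j ∈ Finset.range P, (Tapp ν K)^[j] f x
      ≤ ∑ j ∈ Finset.range P, ⨆ n, (Tapp (ν.restrict (E n)) K)^[j] f x :=
        Finset.sum_le_sum fun j _ => key j x
    _ = ⨆ n, ∑ j ∈ Finset.range P, (Tapp (ν.restrict (E n)) K)^[j] f x :=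
        ENNReal.finsetSum_iSup_of_monotone fun j => hmono j x
    _ ≤ C := iSup_le fun n => (ENNReal.sum_le_tsum _).trans (h n)

lemma exists_pow_mul_le_one {r c : ℝ≥0∞} (hr : r < 1) (hc : c ≠ ∞) : ∃ n : ℕ, r ^ n * c ≤ 1 := by
  have h := ENNReal.Tendsto.mul_const (b := c)
    (ENNReal.tendsto_pow_atTop_nhds_zero_of_lt_one hr) (Or.inr hc)
  rw [zero_mul] at h
  obtain ⟨n, hn⟩ := (h.eventually_lt_const zero_lt_one).exists
  exact ⟨n, hn.le⟩

lemma exists_neumann_one_le [SFinite ν] (hK : Measurable fun p : Ω × Ω => K p.1 p.2)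
    (hs : ∀ x y, K x y = K y x) (hpos : ∀ x y, K x y ≠ 0) {L : ℝ≥0∞} (hL : 1 ≤ L) (hLt : L ≠ ∞)
    (hQ : ∀ x y z, min (K x z) (K z y) ≤ L * K x y) {q : ℝ≥0∞} (hq : q < 1)
    (hb : L2Bound ν K q) {M : ℝ≥0∞} (hM : M ≠ ∞) (hKM : ∀ x, ∫⁻ z, K x z ∂ν ≤ M) :
    ∃ C : ℝ≥0∞, C ≠ ∞ ∧ ∀ x, neumann ν K (fun _ => 1) x ≤ C := by
  obtain ⟨J, hJ⟩ := exists_pow_mul_le_one hq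
    (ENNReal.mul_ne_top hLt (by norm_num : (2 : ℝ≥0∞) ≠ ∞))
  refine ⟨ENNReal.ofReal (Real.exp (2 * (J * (L + L ^ (J + 1))) * (1 - q)⁻¹ * (4 * M)).toReal),
    ENNReal.ofReal_ne_top, fun x => ?_⟩
  have hk := measurable_kernel_right hK x
  have hlow : ∀ n : ℕ, (2 : ℝ≥0∞) ^ n * 2⁻¹ ^ (2 * n) = 2⁻¹ ^ n := fun n => by
    rw [two_mul, pow_add, ← mul_assoc, ← mul_pow,
      ENNReal.mul_inv_cancel (by norm_num) (by norm_num), one_pow, one_mul]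
  refine neumann_le_of_restrict_le hK measurable_const
    (E := fun n => {z | (2 : ℝ≥0∞) ^ n * 2⁻¹ ^ (2 * n) < K x z ∧ K x z ≤ 2 ^ n}) ?_ ?_ ?_
    fun n => neumann_one_restrict_le hK hs hL hLt hQ hq hb hJ hM x (hKM x)
      (pow_ne_zero n (by norm_num)) (ENNReal.pow_ne_top (by norm_num)) (2 * n)
  · intro n n' hn z hz
    simp only [hlow, Set.mem_ofPred_eq] at hz ⊢
    exact ⟨(pow_le_pow_right_of_le_one' (by norm_num) hn).trans_lt hz.1,
      hz.2.trans (pow_le_pow_right' (by norm_num) hn)⟩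
  · exact fun n => (measurableSet_lt measurable_const hk).inter
      (measurableSet_le hk measurable_const)
  · filter_upwards [ae_lt_top hk (ne_top_of_le_ne_top hM (hKM x))] with z hz
    simp only [hlow]
    have h1 := (ENNReal.tendsto_pow_atTop_nhds_zero_of_lt_one
      (by norm_num : (2⁻¹ : ℝ≥0∞) < 1)).eventually_lt_const (pos_iff_ne_zero.mpr (hpos x z))
    have h2 := (ENNReal.tendsto_pow_atTop_nhds_top_iff.mpr
      (by norm_num : (1 : ℝ≥0∞) < 2)).eventually_const_lt hz
    obtain ⟨n, hn1, hn2⟩ := (h1.and h2).exists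
    exact ⟨n, hn1, hn2.le⟩

end Multiscale

/-- for a quasi-metric kernel `K` (not identically `∞`) with
constant `κ`, the following are equivalent:
(a) `Σ_{j=1}^∞ K_j(x,y) ≤ C₁·K(x,y)` for all `x, y`, for some `C₁ > 0`;
(b) `‖T‖ < 1` on `L²(ω)` and `K₂(x,y) ≤ C₂·K(x,y)` for all `x, y`,
    for some `C₂ > 0`;
(c) the minimal positive solution `u₀ = 1 + Σ_{j=1}^∞ T^j 1` of `u = Tu + 1`
    is bounded, i.e. `sup_x u₀(x) < ∞`. -/
theorem green_function_comparable_tfae {Ω : Type*} [MeasurableSpace Ω]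
    (ω : Measure Ω) [SigmaFinite ω] (K : Ω → Ω → ℝ≥0∞) (κ : ℝ≥0)
    (hκ : 0 < κ) (hK : IsQuasiMetricKernel K κ)
    (hfin : ∃ x y, K x y ≠ ∞) :
    ((∃ C₁ : ℝ≥0, 0 < C₁ ∧ ∀ x y,
        (∑' j : ℕ, Kiter ω K j x y) ≤ (C₁ : ℝ≥0∞) * K x y) ↔
      (opNorm ω K < 1 ∧ ∃ C₂ : ℝ≥0, 0 < C₂ ∧ ∀ x y,
        Kiter ω K 1 x y ≤ (C₂ : ℝ≥0∞) * K x y)) ∧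
    ((opNorm ω K < 1 ∧ ∃ C₂ : ℝ≥0, 0 < C₂ ∧ ∀ x y,
        Kiter ω K 1 x y ≤ (C₂ : ℝ≥0∞) * K x y) ↔
      (⨆ x, (1 + ∑' j : ℕ, (Tapp ω K)^[j + 1] (fun _ => 1) x)) < ∞) := by
  set L : ℝ≥0 := max (2 * κ) 1
  have hL : (1 : ℝ≥0∞) ≤ L := by exact_mod_cast le_max_right (2 * κ) 1
  have hLt : (L : ℝ≥0∞) ≠ ∞ := ENNReal.coe_ne_top
  have hm := hK.measurable
  have hs := hK.symm
  have hQ := hK.min_le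
  have hcoe : ∀ {F : Ω → Ω → ℝ≥0∞}, (∃ C : ℝ≥0∞, C ≠ ∞ ∧ ∀ x y, F x y ≤ C * K x y) →
      ∃ C : ℝ≥0, 0 < C ∧ ∀ x y, F x y ≤ (C : ℝ≥0∞) * K x y := by
    rintro F ⟨C, hC, h⟩
    refine ⟨C.toNNReal + 1, by positivity, fun x y => (h x y).trans (mul_le_mul_left ?_ _)⟩
    rw [ENNReal.coe_add, ENNReal.coe_toNNReal hC]
    exact le_self_add
  have hu : ∀ x, 1 + ∑' j : ℕ, (Tapp ω K)^[j + 1] (fun _ => 1) x =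
      neumann ω K (fun _ => 1) x := fun x => by
    simp only [neumann]
    rw [tsum_eq_zero_add' (f := fun j => (Tapp ω K)^[j] (fun _ => 1) x) ENNReal.summable]
    rfl
  simp only [hu]
  set bounded := (⨆ x, neumann ω K (fun _ => 1) x) < ∞
  have of_bound : ∀ {M : ℝ≥0∞}, M ≠ ∞ → (∀ x, neumann ω K (fun _ => 1) x ≤ M) → bounded :=
    fun hM h => (iSup_le h).trans_lt hM.lt_top
  have exists_bound : bounded → ∃ M : ℝ≥0∞, M ≠ ∞ ∧ 1 ≤ M ∧
      ∀ x, neumann ω K (fun _ => 1) x ≤ M := fun h =>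
    ⟨max _ 1, max_ne_top h.ne ENNReal.one_ne_top, le_max_right _ _,
      fun x => (le_iSup (fun x => neumann ω K (fun _ => 1) x) x).trans (le_max_left _ _)⟩
  have hr : ∀ {M : ℝ≥0∞}, M ≠ ∞ → 1 - M⁻¹ < 1 := fun hM =>
    ENNReal.sub_lt_self ENNReal.one_ne_top one_ne_zero (ENNReal.inv_ne_zero.mpr hM)
  have sum_to_bounded : (∃ C₁ : ℝ≥0, 0 < C₁ ∧ ∀ x y,
      (∑' j : ℕ, Kiter ω K j x y) ≤ (C₁ : ℝ≥0∞) * K x y) → bounded := by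
    rintro ⟨C, -, hC⟩
    have hT := lintegral_kernel_le hm hs hK.pos hLt hQ hfin
      fun x y => (ENNReal.le_tsum (f := fun j => Kiter ω K j x y) 1).trans (hC x y)
    refine of_bound (M := 1 + C * (L * C)) (by finiteness) fun x => ?_
    rw [← hu]
    refine add_le_add le_rfl ?_
    simp only [← lintegral_Kiter hm]
    rw [← lintegral_tsum fun j =>
      (measurable_kernel_right (measurable_Kiter hm j) x).aemeasurable]
    calc _ ≤ ∫⁻ y, C * K x y ∂ω := lintegral_mono (hC x)
      _ = C * ∫⁻ y, K x y ∂ω := lintegral_const_mul _ (measurable_kernel_right hm x)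
      _ ≤ C * (L * C) := mul_le_mul_right (hT x) _
  have bounded_to_sum : bounded → ∃ C₁ : ℝ≥0, 0 < C₁ ∧ ∀ x y,
      (∑' j : ℕ, Kiter ω K j x y) ≤ (C₁ : ℝ≥0∞) * K x y := by
    intro hbd
    obtain ⟨M, hM, hM1, hMu⟩ := exists_bound hbd
    obtain ⟨N, hN⟩ := exists_pow_mul_le_one (hr hM) (c := L * M * 2) (by finiteness)
    refine hcoe (exists_tsum_Kiter_le hm hs hLt hQ hM hMu
      (fun x => Tapp_iterate_one_le hm hM hM1 hMu (N + 1) x) ?_)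
    calc L * ((1 - M⁻¹) ^ (N + 1) * M) * 2 = (1 - M⁻¹) * ((1 - M⁻¹) ^ N * (L * M * 2)) := by ring
      _ ≤ 1 * 1 := mul_le_mul' (hr hM).le hN
      _ = 1 := one_mul 1
  have norm_to_bounded : (opNorm ω K < 1 ∧ ∃ C₂ : ℝ≥0, 0 < C₂ ∧ ∀ x y,
      Kiter ω K 1 x y ≤ (C₂ : ℝ≥0∞) * K x y) → bounded := by
    rintro ⟨hn, C, -, hC⟩
    have hT := lintegral_kernel_le hm hs hK.pos hLt hQ hfin hC
    obtain ⟨q, hq, hq1⟩ := ENNReal.lt_iff_exists_nnreal_btwn.mp hn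
    obtain ⟨M, hM, hMu⟩ := exists_neumann_one_le hm hs hK.pos hL hLt hQ hq1
      (L2Bound_of_opNorm_lt hq hm) (by finiteness) hT
    exact of_bound hM hMu
  have bounded_to_norm : bounded → opNorm ω K < 1 ∧ ∃ C₂ : ℝ≥0, 0 < C₂ ∧ ∀ x y,
      Kiter ω K 1 x y ≤ (C₂ : ℝ≥0∞) * K x y := by
    intro hbd
    obtain ⟨M, hM, hM1, hMu⟩ := exists_bound hbd
    refine ⟨(opNorm_le_of_Tapp_le hm hs (measurable_neumann hm measurable_const) (fun x => ?_)
      (fun x => ne_top_of_le_ne_top hM (hMu x))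
      (Tapp_neumann_one_le hm hM hM1 hMu)).trans_lt (hr hM), ?_⟩
    · rw [← hu]
      exact (zero_lt_one.trans_le le_self_add).ne'
    · have hT : ∀ x, ∫⁻ y, K x y ∂ω ≤ M := fun x =>
        (lintegral_Kiter hm 0 x).trans_le ((ENNReal.le_tsum 1).trans (hMu x))
      refine hcoe ⟨L * (1 * M + 1 * M), by finiteness, fun x y => ?_⟩
      have hcol : Measurable fun z => K z y := by
        simpa only [hs _ y] using measurable_kernel_right hm y
      refine (lintegral_mul_le_of_le_kernel hQ (f := K) (g := K) (a := 1) (b := 1)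
        (fun x y => by rw [one_mul]) (fun x y => by rw [one_mul]) x y
        (measurable_kernel_right hm x) hcol).trans ?_
      rw [mul_right_comm]
      refine mul_le_mul_left (mul_le_mul_right (add_le_add (mul_le_mul_right ?_ _)
        (mul_le_mul_right (hT x) _)) _) _
      simpa only [hs _ y] using hT y
  exact ⟨⟨fun h => bounded_to_norm (sum_to_bounded h), fun h => bounded_to_sum (norm_to_bounded h)⟩,
    norm_to_bounded, bounded_to_norm⟩
end

section
/- Let (Ω, ω) be a σ-finite measure space and K a quasi-metric kernel with constant κ on Ω. If T1(x) = ∫_Ω K(x,y) dω(y) satisfies T1(x) ≤ M for ω-almost every x ∈ Ω, then T1(x) ≤ 3κM for every x ∈ Ω. -/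
open MeasureTheory ENNReal
open scoped NNReal

/-- Inverting both sides of `a⁻¹ ≤ c * s` in `ℝ≥0∞`. -/
lemma ENNReal.inv_le_mul_of_inv_le_mul {a c s : ℝ≥0∞} (hc : c ≠ 0) (hc' : c ≠ ∞)
    (h : a⁻¹ ≤ c * s) : s⁻¹ ≤ c * a := by
  have h1 : (c * s)⁻¹ ≤ a := ENNReal.inv_le_iff_inv_le.mp h
  rw [ENNReal.mul_inv (Or.inl hc) (Or.inl hc')] at h1
  calc s⁻¹ = c * (c⁻¹ * s⁻¹) := by
        rw [← mul_assoc, ENNReal.mul_inv_cancel hc hc', one_mul]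
    _ ≤ c * a := by gcongr

/-- for a quasi-metric kernel `K` with constant `κ`, if
`T1(x) = ∫ K(x,y) dω(y) ≤ M` for `ω`-almost every `x`, then
`T1(x) ≤ 3κM` for every `x`. -/
theorem T1_everywhere_bound_of_ae_bound {Ω : Type*} [MeasurableSpace Ω]
    (ω : Measure Ω) [SigmaFinite ω] (K : Ω → Ω → ℝ≥0∞) (κ : ℝ≥0)
    (hκ : 0 < κ) (hK : IsQuasiMetricKernel K κ) (M : ℝ≥0)
    (h : ∀ᵐ x ∂ω, (∫⁻ y, K x y ∂ω) ≤ M) :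
    ∀ x, (∫⁻ y, K x y ∂ω) ≤ 3 * (κ : ℝ≥0∞) * M := by
  intro x
  have hκ0 : (κ : ℝ≥0∞) ≠ 0 := by exact_mod_cast hκ.ne'
  have hm : ∀ z, Measurable (K z) := fun z => hK.measurable.comp measurable_prodMk_left
  set A : Set Ω := {z | (∫⁻ y, K z y ∂ω) ≤ M}
  set r : ℝ≥0∞ := ⨅ z ∈ A, (K x z)⁻¹ with hr
  have tri : ∀ z y, (K z y)⁻¹ ≤ κ * ((K x z)⁻¹ + (K x y)⁻¹) := fun z y => by
    rw [hK.symm x z]; exact hK.tri z y x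
  by_cases hr0 : r = 0
  · have hz : ∀ n : ℕ, ∃ z ∈ A, (K x z)⁻¹ < ((n : ℝ≥0∞) + 1)⁻¹ := fun n => by
      have : r < ((n : ℝ≥0∞) + 1)⁻¹ := by
        rw [hr0]; exact ENNReal.inv_pos.mpr (by finiteness)
      simpa [hr, iInf_lt_iff] using this
    choose z hzA hz using hz
    have hlim : Filter.Tendsto (fun n => (K x (z n))⁻¹) Filter.atTop (nhds 0) := by
      refine tendsto_of_tendsto_of_tendsto_of_le_of_le tendsto_const_nhds ?_
        (fun _ => zero_le) (fun n => (hz n).le)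
      have := ENNReal.tendsto_inv_nat_nhds_zero.comp (Filter.tendsto_add_atTop_nat 1)
      simpa [Function.comp_def] using this
    have hlim' : ∀ y, Filter.Tendsto (fun n => ((K x (z n))⁻¹ + (K x y)⁻¹)⁻¹)
        Filter.atTop (nhds (K x y)) := fun y => by
      simpa using (hlim.add_const (K x y)⁻¹).inv
    calc ∫⁻ y, K x y ∂ω
        = ∫⁻ y, Filter.liminf (fun n => ((K x (z n))⁻¹ + (K x y)⁻¹)⁻¹) Filter.atTop ∂ω :=
          lintegral_congr fun y => (hlim' y).liminf_eq.symm
      _ ≤ Filter.liminf (fun n => ∫⁻ y, ((K x (z n))⁻¹ + (K x y)⁻¹)⁻¹ ∂ω) Filter.atTop :=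
          lintegral_liminf_le fun n => ((hm x).inv.const_add _).inv
      _ ≤ Filter.liminf (fun _ : ℕ => (κ : ℝ≥0∞) * M) Filter.atTop := by
          refine Filter.liminf_le_liminf (Filter.Eventually.of_forall fun n => ?_)
          calc ∫⁻ y, ((K x (z n))⁻¹ + (K x y)⁻¹)⁻¹ ∂ω
              ≤ ∫⁻ y, κ * K (z n) y ∂ω := lintegral_mono fun y =>
                ENNReal.inv_le_mul_of_inv_le_mul hκ0 coe_ne_top (tri (z n) y)
            _ = κ * ∫⁻ y, K (z n) y ∂ω := lintegral_const_mul _ (hm _)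
            _ ≤ κ * M := by gcongr; exact hzA n
      _ = 1 * κ * M := by simp
      _ ≤ 3 * κ * M := by gcongr; norm_num
  · rcases A.eq_empty_or_nonempty with hA | ⟨a, ha⟩
    · have : ω = 0 := by
        rw [← ae_eq_bot, ← Filter.eventually_false_iff_eq_bot]
        filter_upwards [h] with z hz
        exact (hA ▸ (show z ∈ A from hz) : z ∈ (∅ : Set Ω))
      simp [this]
    · have hrt : r ≠ ∞ :=
        ne_top_of_le_ne_top (ENNReal.inv_ne_top.mpr (hK.pos x a)) (iInf₂_le a ha)
      obtain ⟨z, hzA, hz⟩ : ∃ z ∈ A, (K x z)⁻¹ < 2 * r := by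
        have : r < 2 * r := by
          rw [two_mul]; exact ENNReal.lt_add_right hrt hr0
        rw [hr] at this
        simpa only [iInf_lt_iff, exists_prop] using this
      calc ∫⁻ y, K x y ∂ω ≤ ∫⁻ y, 3 * κ * K z y ∂ω := by
            refine lintegral_mono_ae ?_
            filter_upwards [h] with y hy
            rw [← inv_inv (K x y)]
            refine ENNReal.inv_le_mul_of_inv_le_mul (by simp [hκ0]) (by finiteness) ?_
            have hry : r ≤ (K x y)⁻¹ := iInf₂_le y hy
            calc (K z y)⁻¹ ≤ κ * ((K x z)⁻¹ + (K x y)⁻¹) := tri z y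
              _ ≤ κ * (2 * (K x y)⁻¹ + (K x y)⁻¹) := by
                gcongr; exact hz.le.trans (by gcongr)
              _ = 3 * κ * (K x y)⁻¹ := by ring
        _ = 3 * κ * ∫⁻ y, K z y ∂ω := lintegral_const_mul _ (hm _)
        _ ≤ 3 * κ * M := by gcongr; exact hzA
end

section
/- Let Ω be a set, w ∈ Ω, and K : Ω × Ω → (0, ∞] a symmetric kernel with K(x,w) < ∞ for all x ∈ Ω. Suppose D = 1/K satisfies the Ptolemy inequality D(x,y)·D(z,w) ≤ C·( D(x,z)·D(y,w) + D(x,w)·D(y,z) ) for all x, y, z ∈ Ω and some constant C > 0. Then m(x) = K(x,w) is a quasi-metric modifier for K: the function d̃(x,y) = m(x)·m(y)·D(x,y) = D(x,y)/(D(x,w)·D(y,w)) satisfies the quasi-triangle inequality d̃(x,y) ≤ C·( d̃(x,z) + d̃(z,y) ) for all x, y, z ∈ Ω. -/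
open scoped ENNReal NNReal

/-- let `K : Ω × Ω → (0,∞]` be a symmetric kernel with
`K(x,w) < ∞` for all `x`, and suppose `D = 1/K` satisfies the Ptolemy
inequality `D(x,y)·D(z,w) ≤ C·(D(x,z)·D(y,w) + D(x,w)·D(y,z))`.
Then `m(x) = K(x,w)` is a quasi-metric modifier for `K`: the function
`d̃(x,y) = m(x)·m(y)·D(x,y) = D(x,y)/(D(x,w)·D(y,w))` satisfies the
quasi-triangle inequality `d̃(x,y) ≤ C·(d̃(x,z) + d̃(z,y))`. -/
theorem ptolemy_gives_modifier {Ω : Type*} (K : Ω → Ω → ℝ≥0∞) (w : Ω)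
    (hpos : ∀ x y, K x y ≠ 0) (hsymm : ∀ x y, K x y = K y x)
    (hfin : ∀ x, K x w ≠ ∞) (C : ℝ≥0) (hC : 0 < C)
    (hPt : ∀ x y z, (K x y)⁻¹ * (K z w)⁻¹ ≤
      (C : ℝ≥0∞) * ((K x z)⁻¹ * (K y w)⁻¹ + (K x w)⁻¹ * (K y z)⁻¹)) :
    ∀ x y z, K x w * K y w * (K x y)⁻¹ ≤
      (C : ℝ≥0∞) * (K x w * K z w * (K x z)⁻¹ + K z w * K y w * (K z y)⁻¹) := by
  intro x y z
  have cancel (u : Ω) : K u w * (K u w)⁻¹ = 1 := ENNReal.mul_inv_cancel (hpos u w) (hfin u)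
  calc K x w * K y w * (K x y)⁻¹
      = K x w * K y w * (K x y)⁻¹ * (K z w * (K z w)⁻¹) := by rw [cancel, mul_one]
    _ = K x w * K y w * K z w * ((K x y)⁻¹ * (K z w)⁻¹) := by ring
    _ ≤ K x w * K y w * K z w *
          (C * ((K x z)⁻¹ * (K y w)⁻¹ + (K x w)⁻¹ * (K y z)⁻¹)) :=
        mul_le_mul_right (hPt x y z) _
    _ = C * (K x w * K z w * (K x z)⁻¹ * (K y w * (K y w)⁻¹) +
          K z w * K y w * (K y z)⁻¹ * (K x w * (K x w)⁻¹)) := by ring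
    _ = C * (K x w * K z w * (K x z)⁻¹ + K z w * K y w * (K z y)⁻¹) := by
        rw [cancel, cancel, mul_one, mul_one, hsymm y z]
end
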